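/- Let V : ℝ×ℝ³ → ℝ be smooth and compactly supported, and let Ṽ(s,·) denote its spatial Fourier transform. Then for every t ≥ 1 the kernel τ'(p⃗,q⃗) = ∫₁^t conj(v(s,|p⃗|))·Ṽ(s, p⃗+q⃗)·conj(v(s,|q⃗|)) ds is square-integrable: ∫_{ℝ³}∫_{ℝ³} |τ'(p⃗,q⃗)|² dp⃗ dq⃗ < ∞. (This is the key Hilbert–Schmidt estimate for the first-order Dyson term in the proof that the perturbed dynamics is unitarily implementable relative to the free dynamics.) -/

import Mathlib

open Complex MeasureTheory Filter
open scoped RealInnerProductSpace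

noncomputable section

/-- Three-dimensional Euclidean space. -/
abbrev V3 : Type := EuclideanSpace ℝ (Fin 3)

/-- The Bessel function of complex order `α`:
`J_α(x) = Σ_{n=0}^∞ ((−1)^n/(n!·Γ(α+n+1)))·exp((α+2n)·log(x/2))`. -/
def besselJ (α : ℂ) (x : ℝ) : ℂ :=
  ∑' n : ℕ, ((-1 : ℂ) ^ n / ((n.factorial : ℂ) * Complex.Gamma (α + (n : ℂ) + 1))) *
    Complex.exp ((α + 2 * (n : ℂ)) * (Real.log (x / 2) : ℂ))

/-- The Hankel function of the first kind. -/
def hankel1 (α : ℂ) (x : ℝ) : ℂ :=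
  (besselJ (-α) x - Complex.exp (-(Complex.I * (Real.pi : ℂ) * α)) * besselJ α x) /
    (Complex.I * Complex.sin (α * (Real.pi : ℂ)))

/-- The Hankel function of the second kind. -/
def hankel2 (α : ℂ) (x : ℝ) : ℂ :=
  (Complex.exp (Complex.I * (Real.pi : ℂ) * α) * besselJ α x - besselJ (-α) x) /
    (Complex.I * Complex.sin (α * (Real.pi : ℂ)))

/-- `μ = √((mR)² − 9/4)`. -/
def modeMu (m R : ℝ) : ℝ := Real.sqrt ((m * R) ^ 2 - 9 / 4)

/-- `ν = iμ`. -/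
def modeNu (m R : ℝ) : ℂ := Complex.I * (modeMu m R : ℂ)

/-- The mode function `v(t,k) = e^{−μπ/2}·t^{3/2}·H^{(1)}_ν(kt)`. -/
def modeV (m R t k : ℝ) : ℂ :=
  (Real.exp (-(modeMu m R * Real.pi / 2)) : ℂ) * ((t ^ ((3 : ℝ) / 2) : ℝ) : ℂ) *
    hankel1 (modeNu m R) (k * t)

/-- `v′(t,k) = ∂v/∂t (t,k)`. -/
def modeV' (m R t k : ℝ) : ℂ := deriv (fun s => modeV m R s k) t

/-- `ω(k) = √(1+k²)`. -/
def omegaK (k : ℝ) : ℝ := Real.sqrt (1 + k ^ 2)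

/-- The Fourier transform on `ℝ³`. -/
def ft (g : V3 → ℂ) (k : V3) : ℂ :=
  (((2 * Real.pi) ^ (-(3 : ℝ) / 2) : ℝ) : ℂ) *
    ∫ x : V3, Complex.exp (-(Complex.I) * (⟪k, x⟫ : ℂ)) * g x

/-- The inverse Fourier transform on `ℝ³`. -/
def ift (g : V3 → ℂ) (x : V3) : ℂ :=
  (((2 * Real.pi) ^ (-(3 : ℝ) / 2) : ℝ) : ℂ) *
    ∫ k : V3, Complex.exp (Complex.I * (⟪k, x⟫ : ℂ)) * g k

/-- The map `K_t` on the Fourier side, applied to the Fourier transforms `f̃, h̃`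
of the Cauchy data:
`K_t(f,h)(k) = (πi/(4t³))·[t·f̃(k)·conj(v′(t,|k|)) − R·h̃(k)·conj(v(t,|k|))]`. -/
def ktAux (m R t : ℝ) (ftil htil : V3 → ℂ) (k : V3) : ℂ :=
  ((Real.pi : ℂ) * Complex.I / (4 * (t : ℂ) ^ 3)) *
    ((t : ℂ) * ftil k * (starRingEnd ℂ) (modeV' m R t ‖k‖) -
      (R : ℂ) * htil k * (starRingEnd ℂ) (modeV m R t ‖k‖))

/-- `K_t` applied to real Cauchy data `(f,h)`. -/
def ktFun (m R t : ℝ) (f h : V3 → ℝ) : V3 → ℂ :=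
  ktAux m R t (ft fun x => (f x : ℂ)) (ft fun x => (h x : ℂ))

/-- The Fourier transform of the first component of the pair `L_tψ`:
`f̃_t(k) = v(t,|k|)·ψ(k) + conj(v(t,|k|))·conj(ψ(−k))`. -/
def ltF (m R t : ℝ) (ψ : V3 → ℂ) (k : V3) : ℂ :=
  modeV m R t ‖k‖ * ψ k + (starRingEnd ℂ) (modeV m R t ‖k‖) * (starRingEnd ℂ) (ψ (-k))

/-- The Fourier transform of the second component of the pair `L_tψ`:
`h̃_t(k) = (t/R)·[v′(t,|k|)·ψ(k) + conj(v′(t,|k|))·conj(ψ(−k))]`. -/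
def ltH (m R t : ℝ) (ψ : V3 → ℂ) (k : V3) : ℂ :=
  ((t / R : ℝ) : ℂ) *
    (modeV' m R t ‖k‖ * ψ k + (starRingEnd ℂ) (modeV' m R t ‖k‖) * (starRingEnd ℂ) (ψ (-k)))

/-- The solution `u(t,x⃗)` built from the coefficient function `ψ`:
`u(t,x⃗) = (2π)^{−3/2}·∫ e^{ik⃗·x⃗}·[v(t,|k⃗|)·ψ(k⃗) + conj(v(t,|k⃗|))·conj(ψ(−k⃗))] dk⃗`. -/
def uSol (m R : ℝ) (ψ : V3 → ℂ) (t : ℝ) (x : V3) : ℂ :=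
  (((2 * Real.pi) ^ (-(3 : ℝ) / 2) : ℝ) : ℂ) *
    ∫ k : V3, Complex.exp (Complex.I * (⟪k, x⟫ : ℂ)) *
      (modeV m R t ‖k‖ * ψ k + (starRingEnd ℂ) (modeV m R t ‖k‖) * (starRingEnd ℂ) (ψ (-k)))

/-- The spatial Laplacian, as the sum of the second partial derivatives along
the coordinate directions. -/
def lap3 (w : V3 → ℂ) (x : V3) : ℂ :=
  ∑ i : Fin 3, iteratedDeriv 2 (fun s : ℝ => w (x + s • EuclideanSpace.single i (1 : ℝ))) 0

/-- The square of the Sobolev-type norm `‖(f,h)‖_{1/2}`, expressed in terms of the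
Fourier transforms `f̃, h̃` of the data:
`‖(f,h)‖_{1/2}² = ∫ ω(|k⃗|)·|f̃(k⃗)|² dk⃗ + ∫ ω(|k⃗|)⁻¹·|h̃(k⃗)|² dk⃗`. -/
def halfNormSq (ftil htil : V3 → ℂ) : ℝ :=
  (∫ k : V3, omegaK ‖k‖ * ‖ftil k‖ ^ 2) + ∫ k : V3, (omegaK ‖k‖)⁻¹ * ‖htil k‖ ^ 2

/-- The Sobolev-type norm `‖(f,h)‖_{1/2}` (arguments are the Fourier transforms). -/
def halfNorm (ftil htil : V3 → ℂ) : ℝ := Real.sqrt (halfNormSq ftil htil)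

/-- The `L²(ℝ³)` norm. -/
def l2Norm (g : V3 → ℂ) : ℝ := Real.sqrt (∫ k : V3, ‖g k‖ ^ 2)

/-- The transformed potential operator `V̂` with (Fourier-transformed) potential `W`:
`(V̂ψ)(k⃗) = −(2π)^{3/2}·R·(πi/4)·conj(v(1,|k⃗|))·(W ∗ g_ψ)(k⃗)` where
`g_ψ(k⃗) = v(1,|k⃗|)·ψ(k⃗) + conj(v(1,|k⃗|))·conj(ψ(−k⃗))`. -/
def vHatOp (m R : ℝ) (W : V3 → ℂ) (ψ : V3 → ℂ) (k : V3) : ℂ :=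
  ((-((2 * Real.pi) ^ ((3 : ℝ) / 2)) * R : ℝ) : ℂ) * ((Real.pi : ℂ) * Complex.I / 4) *
    (starRingEnd ℂ) (modeV m R 1 ‖k‖) * ∫ y : V3, W y * ltF m R 1 ψ (k - y)

/-- The free transformed evolution `Û₀(a,b) = K₁ ∘ L_a ∘ K_b ∘ L₁` on `L²(ℝ³)`. -/
def u0Hat (m R a b : ℝ) (ψ : V3 → ℂ) : V3 → ℂ :=
  ktAux m R 1 (ltF m R a (ktAux m R b (ltF m R 1 ψ) (ltH m R 1 ψ)))
    (ltH m R a (ktAux m R b (ltF m R 1 ψ) (ltH m R 1 ψ)))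

/-- The inner chain `V̂(s)·V̂(s₂)···V̂(s_{j+1})·Û₀(s_{j+1},1)ψ` of the `n`-th Dyson term,
with the nested integrals `∫₁^{s}···` built in; `W s` is the spatial Fourier transform
of the potential at time `s`. -/
def dysonM (m R : ℝ) (W : ℝ → V3 → ℂ) : ℕ → ℝ → (V3 → ℂ) → V3 → ℂ
  | 0, s, ψ => vHatOp m R (W s) (u0Hat m R s 1 ψ)
  | j + 1, s, ψ => vHatOp m R (W s) fun k => ∫ r in Set.Ioc (1 : ℝ) s, dysonM m R W j r ψ k

/-- The `n`-th Dyson term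
`∫₁^t∫₁^{s₁}···∫₁^{s_{n−1}} Û₀(t,s₁)·V̂(s₁)···V̂(s_n)·Û₀(s_n,1)ψ ds_n···ds₁` (for `n ≥ 1`). -/
def dysonT (m R : ℝ) (W : ℝ → V3 → ℂ) (n : ℕ) (t : ℝ) (ψ : V3 → ℂ) : V3 → ℂ := fun k =>
  ∫ s in Set.Ioc (1 : ℝ) t, u0Hat m R t s (dysonM m R W (n - 1) s ψ) k

/-! ### The entire function behind the Bessel series -/

/-- Coefficients of the Bessel series. -/
def bC (α : ℂ) (n : ℕ) : ℂ := (-1 : ℂ) ^ n / ((n.factorial : ℂ) * Complex.Gamma (α + (n : ℂ) + 1))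

/-- The entire function `Σ (-w)^n/(n! Γ(α+n+1))`. -/
def bE (α w : ℂ) : ℂ := ∑' n : ℕ, bC α n * w ^ n

lemma gamma_inv_bound (α : ℂ) (hα : 0 ≤ α.re) (n : ℕ) :
    ‖(Complex.Gamma (α + (n : ℂ) + 1))⁻¹‖ ≤ ‖(Complex.Gamma (α + 1))⁻¹‖ / n.factorial := by
  induction n with
  | zero => simp
  | succ n ih =>
    have h1 : α + ((n + 1 : ℕ) : ℂ) + 1 = (α + (n : ℂ) + 1) + 1 := by push_cast; ring
    have hre : (n + 1 : ℝ) ≤ (α + (n : ℂ) + 1).re := by simp; linarith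
    have hne : α + (n : ℂ) + 1 ≠ 0 := by
      intro h
      rw [h] at hre
      simp at hre
      have : (0 : ℝ) ≤ n := Nat.cast_nonneg n
      linarith
    have hnorm : (n + 1 : ℝ) ≤ ‖α + (n : ℂ) + 1‖ := hre.trans (Complex.re_le_norm _)
    rw [h1, Complex.Gamma_add_one _ hne, mul_inv, norm_mul, norm_inv, Nat.factorial_succ]
    have hpos : (0 : ℝ) < n + 1 := by positivity
    calc ‖α + (n : ℂ) + 1‖⁻¹ * ‖(Complex.Gamma (α + (n : ℂ) + 1))⁻¹‖
        ≤ (n + 1 : ℝ)⁻¹ * (‖(Complex.Gamma (α + 1))⁻¹‖ / n.factorial) := by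
          gcongr
      _ = _ := by push_cast; field_simp

lemma bC_bound (α : ℂ) (hα : 0 ≤ α.re) (n : ℕ) :
    ‖bC α n‖ ≤ ‖(Complex.Gamma (α + 1))⁻¹‖ / ((n.factorial : ℝ) * n.factorial) := by
  have h := gamma_inv_bound α hα n
  have : bC α n = (-1 : ℂ) ^ n * ((n.factorial : ℂ)⁻¹ * (Complex.Gamma (α + (n : ℂ) + 1))⁻¹) := by
    rw [bC, div_eq_mul_inv, mul_inv]
  rw [this, norm_mul, norm_mul]
  simp only [norm_pow, norm_neg, norm_one, one_pow, one_mul]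
  rw [norm_inv, Complex.norm_natCast]
  calc (n.factorial : ℝ)⁻¹ * ‖(Complex.Gamma (α + (n : ℂ) + 1))⁻¹‖
      ≤ (n.factorial : ℝ)⁻¹ * (‖(Complex.Gamma (α + 1))⁻¹‖ / n.factorial) := by gcongr
    _ = _ := by field_simp

lemma bC_bound' (α : ℂ) (hα : 0 ≤ α.re) (n : ℕ) :
    ‖bC α n‖ ≤ ‖(Complex.Gamma (α + 1))⁻¹‖ / (n.factorial : ℝ) := by
  refine (bC_bound α hα n).trans ?_
  have h1 : (1 : ℝ) ≤ n.factorial := by exact_mod_cast Nat.one_le_iff_ne_zero.2 (Nat.factorial_ne_zero n)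
  gcongr
  nlinarith

lemma bE_term_bound (α : ℂ) (hα : 0 ≤ α.re) (n : ℕ) (w : ℂ) (r : ℝ) (hw : ‖w‖ ≤ r) :
    ‖bC α n * w ^ n‖ ≤ ‖(Complex.Gamma (α + 1))⁻¹‖ * (r ^ n / n.factorial) := by
  rw [norm_mul, norm_pow]
  calc ‖bC α n‖ * ‖w‖ ^ n ≤ ‖(Complex.Gamma (α + 1))⁻¹‖ / (n.factorial : ℝ) * r ^ n := by
        gcongr
        exact bC_bound' α hα n
    _ = _ := by ring

lemma bE_summable (α : ℂ) (hα : 0 ≤ α.re) (w : ℂ) : Summable fun n => bC α n * w ^ n := by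
  refine Summable.of_norm_bounded (g := fun n => ‖(Complex.Gamma (α + 1))⁻¹‖ * (‖w‖ ^ n / n.factorial))
    ((Real.summable_pow_div_factorial ‖w‖).mul_left _) fun n => ?_
  exact bE_term_bound α hα n w ‖w‖ le_rfl

lemma bE_norm_le (α : ℂ) (hα : 0 ≤ α.re) (r : ℝ) :
    ∃ C, ∀ w : ℂ, ‖w‖ ≤ r → ‖bE α w‖ ≤ C := by
  refine ⟨_, fun w hw => tsum_of_norm_bounded
    ((Real.summable_pow_div_factorial r).mul_left ‖(Complex.Gamma (α + 1))⁻¹‖).hasSum fun n => ?_⟩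
  exact bE_term_bound α hα n w r hw

lemma bC_succ (α : ℂ) (n : ℕ) : bC α (n + 1) * ((n : ℂ) + 1) = - bC (α + 1) n := by
  unfold bC
  have h1 : α + ((n + 1 : ℕ) : ℂ) + 1 = α + 1 + (n : ℂ) + 1 := by push_cast; ring
  rw [h1, Nat.factorial_succ]
  have : (n : ℂ) + 1 ≠ 0 := by exact_mod_cast Nat.succ_ne_zero n
  have h3 : (n.factorial : ℂ) ≠ 0 := by exact_mod_cast Nat.factorial_ne_zero n
  push_cast
  rw [div_mul_eq_mul_div, ← neg_div, pow_succ, mul_assoc ((n : ℂ) + 1),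
    show (-1 : ℂ) ^ n * -1 * ((n : ℂ) + 1) = ((n : ℂ) + 1) * (-(-1) ^ n) by ring,
    mul_div_mul_left _ _ this]

lemma bE_hasDerivAt (α : ℂ) (hα : 0 ≤ α.re) (w : ℂ) : HasDerivAt (bE α) (-bE (α + 1) w) w := by
  have hα1 : 0 ≤ (α + 1).re := by simp; linarith
  set r := ‖w‖ + 1 with hr
  have key : HasDerivAt (fun z => ∑' n : ℕ, bC α n * z ^ n)
      (∑' n : ℕ, bC α n * ((n : ℂ) * w ^ (n - 1))) w := by
    refine hasDerivAt_tsum_of_isPreconnected (t := Metric.ball (0 : ℂ) r)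
      (g := fun (n : ℕ) (z : ℂ) => bC α n * z ^ n)
      (g' := fun (n : ℕ) (z : ℂ) => bC α n * ((n : ℂ) * z ^ (n - 1)))
      (u := fun n => ‖bC α n * ((n : ℂ) * (r : ℂ) ^ (n - 1))‖) ?_
      Metric.isOpen_ball (Metric.isPreconnected_ball (x := (0 : ℂ)) (r := r)) ?_ ?_ (y₀ := w) ?_ ?_ ?_
    · rw [← summable_nat_add_iff 1]
      have := (bE_summable (α + 1) hα1 (r : ℂ)).norm
      refine this.congr fun n => ?_
      have h := bC_succ α n
      have : bC α (n + 1) * (((n + 1 : ℕ) : ℂ) * (r : ℂ) ^ (n + 1 - 1)) = -(bC (α + 1) n * (r : ℂ) ^ n) := by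
        push_cast
        rw [← mul_assoc, h]; simp
      rw [this, norm_neg]
    · intro n y _
      exact (hasDerivAt_pow n y).const_mul _
    · intro n y hy
      have hy' : ‖y‖ ≤ r := by simpa using (le_of_lt (by simpa using hy : ‖y‖ < r))
      have hr0 : 0 ≤ r := by positivity
      rw [norm_mul, norm_mul, norm_mul, norm_mul, norm_pow, norm_pow, Complex.norm_real,
        Real.norm_of_nonneg hr0]
      gcongr
    · simp [hr]
    · exact bE_summable α hα w
    · simp [hr]
  have e : (∑' n : ℕ, bC α n * ((n : ℂ) * w ^ (n - 1))) = -bE (α + 1) w := by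
    have hs : Summable fun n : ℕ => bC α n * ((n : ℂ) * w ^ (n - 1)) := by
      rw [← summable_nat_add_iff 1]
      refine (bE_summable (α + 1) hα1 w).neg.congr fun n => ?_
      have h := bC_succ α n
      push_cast
      rw [← mul_assoc, h]; simp
    rw [hs.tsum_eq_zero_add]
    simp only [Nat.cast_zero, zero_mul, mul_zero, zero_add]
    rw [bE, ← tsum_neg]
    refine tsum_congr fun n => ?_
    have h := bC_succ α n
    push_cast
    rw [← mul_assoc, h]; simp
  rw [e] at key
  exact key

lemma bE_rec (α : ℂ) (hα : 0 ≤ α.re) (w : ℂ) :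
    w * bE (α + 2) w - (α + 1) * bE (α + 1) w + bE α w = 0 := by
  have hα1 : 0 ≤ (α + 1).re := by simp; linarith
  have hα2 : 0 ≤ (α + 2).re := by simp; linarith
  have h0 := bE_summable α hα w
  have h1 := bE_summable (α + 1) hα1 w
  have h2 := bE_summable (α + 2) hα2 w
  -- `bC α n = (α + n + 1) bC (α+1) n`
  have e1 : ∀ n : ℕ, bC α n * w ^ n = (α + 1) * (bC (α + 1) n * w ^ n) + (n : ℂ) * (bC (α + 1) n * w ^ n) := by
    intro n
    have hne : α + (n : ℂ) + 1 ≠ 0 := by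
      intro h
      have := congrArg Complex.re h
      simp at this
      have h' : (0 : ℝ) ≤ n := Nat.cast_nonneg n
      linarith
    have hg : Complex.Gamma (α + 1 + (n : ℂ) + 1) = (α + (n : ℂ) + 1) * Complex.Gamma (α + (n : ℂ) + 1) := by
      rw [← Complex.Gamma_add_one _ hne]; congr 1; ring
    have hG : Complex.Gamma (α + (n : ℂ) + 1) ≠ 0 := by
      apply Complex.Gamma_ne_zero_of_re_pos
      simp
      have h' : (0 : ℝ) ≤ n := Nat.cast_nonneg n
      linarith
    have h3 : (n.factorial : ℂ) ≠ 0 := by exact_mod_cast Nat.factorial_ne_zero n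
    unfold bC
    rw [hg]
    field_simp
    ring
  have s2 : Summable fun n : ℕ => (n : ℂ) * (bC (α + 1) n * w ^ n) := by
    have := h0.sub (h1.mul_left (α + 1))
    refine this.congr fun n => ?_
    rw [e1 n]; ring
  have e2 : bE α w = (α + 1) * bE (α + 1) w + ∑' n : ℕ, (n : ℂ) * (bC (α + 1) n * w ^ n) := by
    unfold bE
    rw [← tsum_mul_left, ← (h1.mul_left (α + 1)).tsum_add s2]
    exact tsum_congr e1
  have e3 : ∑' n : ℕ, (n : ℂ) * (bC (α + 1) n * w ^ n) = - (w * bE (α + 2) w) := by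
    rw [s2.tsum_eq_zero_add]
    simp only [Nat.cast_zero, zero_mul, zero_add]
    rw [bE, ← tsum_mul_left, ← tsum_neg]
    refine tsum_congr fun n => ?_
    have h := bC_succ (α + 1) n
    rw [show α + 1 + 1 = α + 2 by ring] at h
    push_cast
    rw [show ((n : ℂ) + 1) * (bC (α + 1) (n + 1) * w ^ (n + 1)) =
      (bC (α + 1) (n + 1) * ((n : ℂ) + 1)) * w ^ (n + 1) by ring, h]
    ring
  rw [e2, e3]; ring

lemma besselJ_eq (α : ℂ) (x : ℝ) :
    besselJ α x = Complex.exp (α * (Real.log (x / 2) : ℂ)) *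
      bE α (Complex.exp (2 * (Real.log (x / 2) : ℂ))) := by
  unfold besselJ bE
  rw [← tsum_mul_left]
  refine tsum_congr fun n => ?_
  rw [add_mul, Complex.exp_add, ← Complex.exp_nat_mul, bC]
  rw [show (2 * (n : ℂ)) * (Real.log (x / 2) : ℂ) = (n : ℂ) * (2 * (Real.log (x / 2) : ℂ)) by ring]
  ring

lemma besselJ_eq_of_pos (α : ℂ) (x : ℝ) (hx : 0 < x) :
    besselJ α x = Complex.exp (α * (Real.log (x / 2) : ℂ)) * bE α ((x : ℂ) ^ 2 / 4) := by
  rw [besselJ_eq]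
  congr 2
  rw [two_mul, Complex.exp_add, ← Complex.ofReal_exp, Real.exp_log (by positivity)]
  push_cast; ring

lemma besselJ_measurable (α : ℂ) (hα : 0 ≤ α.re) : Measurable (besselJ α) := by
  have hc : Continuous (bE α) := continuous_iff_continuousAt.2 fun w => (bE_hasDerivAt α hα w).continuousAt
  have : besselJ α = fun x => Complex.exp (α * (Real.log (x / 2) : ℂ)) *
      bE α (Complex.exp (2 * (Real.log (x / 2) : ℂ))) := funext fun x => besselJ_eq α x
  rw [this]
  have hm : Measurable fun x : ℝ => ((Real.log (x / 2) : ℝ) : ℂ) := by fun_prop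
  exact ((hm.const_mul α).cexp).mul (hc.measurable.comp ((hm.const_mul 2).cexp))

lemma besselJ_bdd_small (α : ℂ) (hα : α.re = 0) : ∃ C, ∀ x : ℝ, 0 < x → x ≤ 1 → ‖besselJ α x‖ ≤ C := by
  obtain ⟨C, hC⟩ := bE_norm_le α hα.ge 1
  refine ⟨C, fun x hx hx1 => ?_⟩
  rw [besselJ_eq_of_pos α x hx, norm_mul, Complex.norm_exp]
  have : (α * (Real.log (x / 2) : ℂ)).re = 0 := by simp [hα]
  rw [this, Real.exp_zero, one_mul]
  apply hC
  rw [norm_div, norm_pow, Complex.norm_real, Real.norm_of_nonneg hx.le]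
  norm_num
  nlinarith

/-- The pair of √x J and its derivative solves the normal form of the Bessel equation. -/
lemma besselJ_ode (α : ℂ) (hα : α.re = 0) : ∃ u u1 : ℝ → ℂ,
    (∀ x : ℝ, 0 < x → u x = (Real.sqrt x : ℂ) * besselJ α x) ∧
    (∀ x : ℝ, 0 < x → HasDerivAt u (u1 x) x) ∧
    (∀ x : ℝ, 0 < x → HasDerivAt u1 (-(1 + (1 / 4 - α ^ 2) / (x : ℂ) ^ 2) * u x) x) := by
  have ha0 : 0 ≤ α.re := hα.ge
  have ha1 : 0 ≤ (α + 1).re := by simp; linarith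
  set e : ℝ → ℂ := fun x => Complex.exp ((α + 1 / 2) * (Real.log x : ℂ)) with he
  set c : ℂ := Complex.exp (-(α * (Real.log 2 : ℂ))) with hc
  set w : ℝ → ℂ := fun x => (x : ℂ) ^ 2 / 4 with hw
  have hde : ∀ x : ℝ, 0 < x → HasDerivAt e ((α + 1 / 2) / (x : ℂ) * e x) x := by
    intro x hx
    have h1 := (Real.hasDerivAt_log hx.ne').ofReal_comp
    have h2 := (h1.const_mul (α + 1 / 2)).cexp
    convert h2 using 1
    push_cast
    simp only [he]
    ring
  have hdw : ∀ x : ℝ, HasDerivAt w ((x : ℂ) / 2) x := by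
    intro x
    have hid : HasDerivAt (fun y : ℝ => (y : ℂ)) 1 x := (hasDerivAt_id x).ofReal_comp
    have h1 := (hid.pow 2).div_const 4
    refine h1.congr_deriv ?_
    push_cast
    ring
  have hE : ∀ β : ℂ, 0 ≤ β.re → ∀ x : ℝ, HasDerivAt (fun x => bE β (w x)) (-bE (β + 1) (w x) * ((x : ℂ) / 2)) x := by
    intro β hβ x
    exact (bE_hasDerivAt β hβ (w x)).comp x (hdw x)
  refine ⟨fun x => c * (e x * bE α (w x)),
    fun x => c * (e x * ((α + 1 / 2) / (x : ℂ) * bE α (w x) - bE (α + 1) (w x) * ((x : ℂ) / 2))), ?_, ?_, ?_⟩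
  · intro x hx
    rw [besselJ_eq_of_pos α x hx, Real.log_div hx.ne' two_ne_zero]
    have : ((Real.sqrt x : ℝ) : ℂ) = Complex.exp (1 / 2 * (Real.log x : ℂ)) := by
      rw [Real.sqrt_eq_rpow, Real.rpow_def_of_pos hx]
      push_cast; congr 1; ring
    rw [this, hc, he, hw]
    simp only
    rw [← mul_assoc, ← mul_assoc, ← Complex.exp_add, ← Complex.exp_add]
    congr 2
    push_cast
    ring
  · intro x hx
    have := ((hde x hx).mul (hE α ha0 x)).const_mul c
    refine this.congr_deriv ?_
    ring
  · intro x hx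
    have hx' : (x : ℂ) ≠ 0 := by exact_mod_cast hx.ne'
    have hid : HasDerivAt (fun y : ℝ => (y : ℂ)) 1 x := (hasDerivAt_id x).ofReal_comp
    have hinv : HasDerivAt (fun y : ℝ => (α + 1 / 2) / (y : ℂ)) (-(α + 1 / 2) / (x : ℂ) ^ 2) x := by
      have := (hasDerivAt_const x (α + 1 / 2)).div hid hx'
      refine this.congr_deriv ?_
      ring
    have := ((hde x hx).mul ((hinv.mul (hE α ha0 x)).sub ((hE (α + 1) ha1 x).mul (hid.div_const 2)))).const_mul c
    refine this.congr_deriv ?_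
    have hrec := bE_rec α ha0 (w x)
    have hr : bE α (w x) = (α + 1) * bE (α + 1) (w x) - (x : ℂ) ^ 2 / 4 * bE (α + 2) (w x) := by
      have : w x = (x : ℂ) ^ 2 / 4 := rfl
      linear_combination hrec - bE (α + 2) (w x) * this
    rw [show α + 1 + 1 = α + 2 by ring]
    simp only [Pi.sub_apply, Pi.mul_apply]
    rw [hr]
    field_simp
    ring

/-! ### Asymptotics for the normal form equation -/

lemma ode_bdd (c : ℝ) (hc : 0 ≤ c) (u u1 : ℝ → ℂ)
    (h1 : ∀ x : ℝ, 0 < x → HasDerivAt u (u1 x) x)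
    (h2 : ∀ x : ℝ, 0 < x → HasDerivAt u1 (-(1 + (c : ℂ) / (x : ℂ) ^ 2) * u x) x) :
    ∃ C, 0 ≤ C ∧ ∀ x : ℝ, 1 ≤ x → ‖u x‖ ≤ C ∧ ‖u1 x‖ ≤ C := by
  set E : ℝ → ℝ := fun x => ‖u1 x‖ ^ 2 + (1 + c / x ^ 2) * ‖u x‖ ^ 2 with hE
  have hd : ∀ x : ℝ, 0 < x → HasDerivAt E (-(2 * c / x ^ 3) * ‖u x‖ ^ 2) x := by
    intro x hx
    have a1 := (h1 x hx).norm_sq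
    have a2 := (h2 x hx).norm_sq
    have a3 : HasDerivAt (fun y : ℝ => 1 + c / y ^ 2) (-(2 * c / x ^ 3)) x := by
      have := ((hasDerivAt_const x c).div (hasDerivAt_pow 2 x) (by positivity)).const_add 1
      refine this.congr_deriv ?_
      field_simp
      ring
    have := a2.add (a3.mul a1)
    refine this.congr_deriv ?_
    have e : -(1 + (c : ℂ) / (x : ℂ) ^ 2) * u x = (-(1 + c / x ^ 2)) • u x := by
      rw [Complex.real_smul]; push_cast; ring
    rw [e, real_inner_smul_right, real_inner_comm (u x) (u1 x)]
    ring
  have hanti : AntitoneOn E (Set.Ici 1) := by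
    refine antitoneOn_of_deriv_nonpos (convex_Ici 1) ?_ ?_ ?_
    · intro x hx
      exact (hd x (lt_of_lt_of_le one_pos hx)).continuousAt.continuousWithinAt
    · intro x hx
      rw [interior_Ici] at hx
      exact (hd x (lt_trans one_pos hx)).differentiableAt.differentiableWithinAt
    · intro x hx
      rw [interior_Ici] at hx
      have hx0 : 0 < x := lt_trans one_pos hx
      rw [(hd x hx0).deriv]
      have : 0 ≤ 2 * c / x ^ 3 * ‖u x‖ ^ 2 := by positivity
      linarith
  refine ⟨Real.sqrt (E 1), Real.sqrt_nonneg _, fun x hx => ?_⟩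
  have hx0 : 0 < x := lt_of_lt_of_le one_pos hx
  have hle : E x ≤ E 1 := hanti (by simp) hx hx
  have hp : 0 ≤ c / x ^ 2 := by positivity
  constructor
  · apply Real.le_sqrt_of_sq_le
    refine le_trans ?_ hle
    simp only [hE]
    nlinarith [sq_nonneg ‖u1 x‖, sq_nonneg ‖u x‖]
  · apply Real.le_sqrt_of_sq_le
    refine le_trans ?_ hle
    simp only [hE]
    nlinarith [sq_nonneg ‖u1 x‖, sq_nonneg ‖u x‖]

lemma ode_asymp (c : ℝ) (hc : 0 ≤ c) (u u1 : ℝ → ℂ) (σ : ℂ) (hσ : σ ^ 2 = -1)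
    (hσ' : σ.re = 0)
    (h1 : ∀ x : ℝ, 0 < x → HasDerivAt u (u1 x) x)
    (h2 : ∀ x : ℝ, 0 < x → HasDerivAt u1 (-(1 + (c : ℂ) / (x : ℂ) ^ 2) * u x) x) :
    ∃ (L : ℂ) (C : ℝ), 0 ≤ C ∧ ∀ x : ℝ, 1 ≤ x →
      ‖u1 x - σ * u x - L * Complex.exp (-(σ * x))‖ ≤ C / x := by
  obtain ⟨B, hB0, hB⟩ := ode_bdd c hc u u1 h1 h2
  set f : ℝ → ℂ := fun x => Complex.exp (σ * x) * (u1 x - σ * u x) with hf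
  set f' : ℝ → ℂ := fun x => -((c : ℂ) / (x : ℂ) ^ 2) * (Complex.exp (σ * x) * u x) with hf'
  have hd : ∀ x : ℝ, 0 < x → HasDerivAt f (f' x) x := by
    intro x hx
    have hid : HasDerivAt (fun y : ℝ => (y : ℂ)) 1 x := (hasDerivAt_id x).ofReal_comp
    have := ((hid.const_mul σ).cexp).mul ((h2 x hx).sub ((h1 x hx).const_mul σ))
    refine this.congr_deriv ?_
    simp only [hf', Pi.sub_apply]
    linear_combination (-Complex.exp (σ * x) * u x) * hσ
  have hexp : ∀ x : ℝ, ‖Complex.exp (σ * x)‖ = 1 := by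
    intro x
    rw [Complex.norm_exp]; simp [hσ']
  have hfb : ∀ x : ℝ, 1 ≤ x → ‖f' x‖ ≤ (c * B) * x ^ (-2 : ℝ) := by
    intro x hx
    have hx0 : 0 < x := lt_of_lt_of_le one_pos hx
    simp only [hf']
    rw [norm_mul, norm_mul, hexp, norm_neg, norm_div, norm_pow, Complex.norm_real, Complex.norm_real,
      Real.norm_of_nonneg hc, Real.norm_of_nonneg hx0.le, one_mul, Real.rpow_neg hx0.le]
    have := (hB x hx).1
    have e : x ^ (2 : ℝ) = x ^ 2 := by norm_cast
    rw [e]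
    calc c / x ^ 2 * ‖u x‖ ≤ c / x ^ 2 * B := by gcongr
      _ = _ := by field_simp
  have hgi : ∀ a : ℝ, 1 ≤ a → IntegrableOn (fun x : ℝ => (c * B) * x ^ (-2 : ℝ)) (Set.Ioi a) := fun a ha =>
    (integrableOn_Ioi_rpow_of_lt (by norm_num) (lt_of_lt_of_le one_pos ha)).const_mul _
  have hcont : ContinuousOn f' (Set.Ioi 0) := by
    have hu : ContinuousOn u (Set.Ioi 0) := fun x hx => (h1 x hx).continuousAt.continuousWithinAt
    simp only [hf']
    refine ContinuousOn.mul (ContinuousOn.neg (ContinuousOn.div (by fun_prop) (by fun_prop) ?_)) ((by fun_prop : Continuous fun x : ℝ => Complex.exp (σ * x)).continuousOn.mul hu)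
    intro x hx
    have : (x : ℂ) ≠ 0 := by exact_mod_cast (ne_of_gt hx)
    exact pow_ne_zero 2 this
  have hfi : ∀ a : ℝ, 1 ≤ a → IntegrableOn f' (Set.Ioi a) := by
    intro a ha
    refine (hgi a ha).mono' ((hcont.mono (Set.Ioi_subset_Ioi (by linarith))).aestronglyMeasurable measurableSet_Ioi) ?_
    refine (ae_restrict_iff' measurableSet_Ioi).2 (Eventually.of_forall fun x hx => hfb x ?_)
    exact ha.trans (le_of_lt hx)
  have hlim := tendsto_limUnder_of_hasDerivAt_of_integrableOn_Ioi (a := 1) (f := f) (f' := f')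
    (fun x hx => hd x (lt_trans one_pos hx)) (hfi 1 le_rfl)
  set L := limUnder atTop f with hL
  refine ⟨L, c * B, by positivity, fun x hx => ?_⟩
  have hx0 : 0 < x := lt_of_lt_of_le one_pos hx
  have hintg := integral_Ioi_of_hasDerivAt_of_tendsto (a := x) (f := f) (f' := f')
    (hd x hx0).continuousAt.continuousWithinAt (fun y hy => hd y (hx0.trans hy)) (hfi x hx) hlim
  have hb : ‖L - f x‖ ≤ c * B / x := by
    rw [← hintg]
    calc ‖∫ y in Set.Ioi x, f' y‖ ≤ ∫ y in Set.Ioi x, (c * B) * y ^ (-2 : ℝ) := by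
          refine norm_integral_le_of_norm_le (hgi x hx) ?_
          refine (ae_restrict_iff' measurableSet_Ioi).2 (Eventually.of_forall fun y hy => hfb y ?_)
          exact hx.trans (le_of_lt hy)
      _ = c * B / x := by
          rw [integral_const_mul, integral_Ioi_rpow_of_lt (by norm_num) hx0]
          norm_num
          rw [Real.rpow_neg_one]
          ring
  have e : u1 x - σ * u x - L * Complex.exp (-(σ * x)) = - (Complex.exp (-(σ * x)) * (L - f x)) := by
    simp only [hf]
    have : Complex.exp (-(σ * x)) * Complex.exp (σ * x) = 1 := by
      rw [← Complex.exp_add]; simp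
    linear_combination (-(u1 x - σ * u x)) * this
  rw [e, norm_neg, norm_mul, show -(σ * (x : ℂ)) = σ * ((-x : ℝ) : ℂ) by push_cast; ring, hexp, one_mul]
  exact hb

/-! ### The Laplace transform of `x^ν J_ν` -/

lemma integrable_rpow_exp (s b : ℝ) (hs : -1 < s) (hb : 0 < b) :
    IntegrableOn (fun x : ℝ => x ^ s * Real.exp (-(b * x))) (Set.Ioi 0) := by
  have := integrableOn_rpow_mul_exp_neg_mul_rpow (p := 1) hs one_pos hb
  simpa using this

lemma laplace_differentiableOn (f : ℝ → ℂ) (hf : AEStronglyMeasurable f (volume.restrict (Set.Ioi 0)))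
    (C p : ℝ) (hp : -1 < p) (hC : ∀ x : ℝ, 0 < x → ‖f x‖ ≤ C * x ^ p) :
    DifferentiableOn ℂ (fun s : ℂ => ∫ x in Set.Ioi (0 : ℝ), f x * Complex.exp (-(s * x))) {s | 0 < s.re} := by
  intro s0 hs0
  have hs0' : 0 < s0.re := hs0
  have hC0 : 0 ≤ C := by
    have := (norm_nonneg _).trans (hC 1 one_pos)
    simpa using this
  have hexpm : ∀ s : ℂ, AEStronglyMeasurable (fun x : ℝ => Complex.exp (-(s * x))) (volume.restrict (Set.Ioi 0)) :=
    fun s => (by fun_prop : Continuous fun x : ℝ => Complex.exp (-(s * x))).aestronglyMeasurable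
  have hnorm : ∀ (s : ℂ) (x : ℝ), ‖Complex.exp (-(s * x))‖ = Real.exp (-(s.re * x)) := by
    intro s x; rw [Complex.norm_exp]; simp
  refine DifferentiableAt.differentiableWithinAt (HasDerivAt.differentiableAt
    (hasDerivAt_integral_of_dominated_loc_of_deriv_le (s := Metric.ball s0 (s0.re / 2))
    (F := fun (s : ℂ) (x : ℝ) => f x * Complex.exp (-(s * x)))
    (F' := fun (s : ℂ) (x : ℝ) => f x * (Complex.exp (-(s * x)) * (-(x : ℂ))))
    (bound := fun x => C * (x ^ (p + 1) * Real.exp (-(s0.re / 2 * x))))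
    (Metric.ball_mem_nhds _ (by positivity)) ?_ ?_ ?_ ?_ ?_ ?_).2)
  · exact Eventually.of_forall fun s => hf.mul (hexpm s)
  · refine ((integrable_rpow_exp p s0.re hp hs0').const_mul C).mono' (hf.mul (hexpm s0)) ?_
    refine (ae_restrict_iff' measurableSet_Ioi).2 (Eventually.of_forall fun x hx => ?_)
    rw [norm_mul, hnorm, ← mul_assoc]
    gcongr
    exact hC x hx
  · exact hf.mul ((hexpm s0).mul (by fun_prop : Continuous fun x : ℝ => (-(x : ℂ))).aestronglyMeasurable)
  · refine (ae_restrict_iff' measurableSet_Ioi).2 (Eventually.of_forall fun x hx s hs => ?_)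
    have hx' : 0 < x := hx
    rw [norm_mul, norm_mul, hnorm, norm_neg, Complex.norm_real, Real.norm_of_nonneg hx'.le,
      mul_comm (Real.exp _) x, Real.rpow_add_one hx'.ne', ← mul_assoc, ← mul_assoc, ← mul_assoc]
    have hre : s0.re / 2 ≤ s.re := by
      have h1 : ‖s - s0‖ < s0.re / 2 := by simpa [dist_eq_norm] using hs
      have h2 := (Complex.abs_re_le_norm (s - s0))
      have h3 := abs_le.1 (h2.trans h1.le)
      simp at h3
      linarith [h3.1]
    gcongr
    exact hC x hx
  · exact (integrable_rpow_exp (p + 1) (s0.re / 2) (by linarith) (by positivity)).const_mul C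
  · refine Eventually.of_forall fun x s _ => ?_
    have h1 : HasDerivAt (fun s : ℂ => -(s * (x : ℂ))) (-(x : ℂ)) s := by
      exact ((hasDerivAt_id s).mul_const (x : ℂ)).neg.congr_deriv (by simp)
    exact (h1.cexp).const_mul _

lemma gamma_choose (a : ℂ) (ha : 0 < a.re) (n : ℕ) :
    Complex.Gamma (a + n) / n.factorial = Complex.Gamma a * ((-1) ^ n * Ring.choose (-a) n) := by
  rw [Ring.choose_eq_smul]
  have h3 : (n.factorial : ℂ) ≠ 0 := by exact_mod_cast Nat.factorial_ne_zero n
  have key : Complex.Gamma (a + n) = Complex.Gamma a * ((-1) ^ n * (descPochhammer ℤ n).smeval (-a)) := by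
    clear h3
    induction n with
    | zero => simp
    | succ n ih =>
      have hne : a + (n : ℂ) ≠ 0 := by
        intro h
        have := congrArg Complex.re h
        simp at this
        have h' : (0 : ℝ) ≤ n := Nat.cast_nonneg n
        linarith
      rw [show a + ((n + 1 : ℕ) : ℂ) = a + n + 1 by push_cast; ring, Complex.Gamma_add_one _ hne, ih,
        descPochhammer_succ_right]
      simp [Polynomial.smeval_mul, Polynomial.smeval_natCast]
      ring
  rw [key, smul_eq_mul]
  field_simp

lemma laplace_term_sum (ν : ℂ) (hν : ν.re = 0) (s : ℝ) (hs : 1 < s) :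
    HasSum (fun n : ℕ => Complex.exp (-(ν * (Real.log 2 : ℂ))) * bC ν n * (1 / 4) ^ n *
      ((1 / (s : ℂ)) ^ (2 * ν + 2 * n + 1) * Complex.Gamma (2 * ν + 2 * n + 1)))
      (Complex.exp (ν * (Real.log 2 : ℂ)) * Complex.Gamma (ν + 1 / 2) / (Real.sqrt Real.pi : ℂ) *
        ((s : ℂ) ^ 2 + 1) ^ (-(ν + 1 / 2))) := by
  have hs0 : 0 < s := by linarith
  have hsc : (s : ℂ) ≠ 0 := by exact_mod_cast hs0.ne'
  set a : ℂ := ν + 1 / 2 with ha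
  have hare : 0 < a.re := by simp [ha, hν]
  have hbin := (Complex.one_add_cpow_hasFPowerSeriesOnBall_zero (a := -a)).hasSum
    (y := ((1 / s ^ 2 : ℝ) : ℂ)) (by
      rw [Metric.mem_eball, edist_zero_right, ← ofReal_norm, ENNReal.ofReal_lt_one, Complex.norm_real,
        Real.norm_of_nonneg (by positivity), div_lt_one (by positivity)]
      nlinarith)
  rw [zero_add] at hbin
  simp only [binomialSeries_apply, List.ofFn_const, List.prod_replicate, smul_eq_mul] at hbin
  have h2 : Complex.exp (ν * (Real.log 2 : ℂ)) ≠ 0 := Complex.exp_ne_zero _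
  have hpi : (Real.sqrt Real.pi : ℂ) ≠ 0 := by
    exact_mod_cast (Real.sqrt_pos.2 Real.pi_pos).ne'
  have hbig := hbin.mul_left (Complex.exp (ν * (Real.log 2 : ℂ)) * Complex.Gamma a / (Real.sqrt Real.pi : ℂ) *
    Complex.exp (-(2 * a * (Real.log s : ℂ))))
  have hgen : ∀ (F G : ℕ → ℂ) (A B : ℂ), HasSum G B → (∀ n, F n = G n) → A = B → HasSum F A := by
    intro F G A B h h1 h2
    rw [funext h1, h2]; exact h
  refine hgen _ _ _ _ hbig (fun n => ?_) ?_
  · have hdup := Complex.Gamma_mul_Gamma_add_half (a + n)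
    have hgc := gamma_choose a hare n
    have hG : Complex.Gamma (ν + (n : ℂ) + 1) ≠ 0 := by
      apply Complex.Gamma_ne_zero_of_re_pos
      simp [hν]
      positivity
    have h3 : (n.factorial : ℂ) ≠ 0 := by exact_mod_cast Nat.factorial_ne_zero n
    rw [show a + (n : ℂ) + 1 / 2 = ν + n + 1 by rw [ha]; ring,
      show 2 * (a + (n : ℂ)) = 2 * ν + 2 * n + 1 by rw [ha]; ring] at hdup
    have e1 : (2 : ℂ) ^ (1 - (2 * ν + 2 * n + 1)) =
        (Complex.exp (ν * (Real.log 2 : ℂ)))⁻¹ * (Complex.exp (ν * (Real.log 2 : ℂ)))⁻¹ * (1 / 4) ^ n := by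
      rw [← Complex.exp_neg, ← Complex.exp_add, Complex.cpow_def_of_ne_zero two_ne_zero]
      have : (1 / 4 : ℂ) ^ n = Complex.exp (-(n * (2 * Real.log 2 : ℂ))) := by
        rw [Complex.exp_neg, Complex.exp_nat_mul, two_mul, Complex.exp_add, ← Complex.ofReal_exp,
          Real.exp_log two_pos, ← inv_pow]
        norm_num
      rw [this, ← Complex.exp_add, ← Complex.ofReal_ofNat, ← Complex.ofReal_log (by norm_num)]
      congr 1
      push_cast
      ring
    have e2 : (1 / (s : ℂ)) ^ (2 * ν + 2 * n + 1) =
        Complex.exp (-(2 * a * (Real.log s : ℂ))) * (((1 / s ^ 2 : ℝ) : ℂ)) ^ n := by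
      rw [Complex.cpow_def_of_ne_zero (by simpa using hsc)]
      have h4 : (((1 / s ^ 2 : ℝ) : ℂ)) ^ n = Complex.exp (-(n * (2 * Real.log s : ℂ))) := by
        rw [Complex.exp_neg, Complex.exp_nat_mul, two_mul, Complex.exp_add, ← Complex.ofReal_exp,
          Real.exp_log hs0, ← inv_pow]
        push_cast
        congr 1
        field_simp
      have h5 : Complex.log (1 / (s : ℂ)) = -(Real.log s : ℂ) := by
        rw [show (1 / (s : ℂ)) = ((s⁻¹ : ℝ) : ℂ) by push_cast; ring, ← Complex.ofReal_log (by positivity),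
          Real.log_inv]
        push_cast; rfl
      rw [h4, h5, ← Complex.exp_add]
      congr 1
      rw [ha]; ring
    rw [e1] at hdup
    rw [e2, Complex.exp_neg]
    unfold bC
    have hdup' : (1 / 4 : ℂ) ^ n * Complex.Gamma (2 * ν + 2 * n + 1) =
        Complex.Gamma (a + n) * Complex.Gamma (ν + n + 1) * Complex.exp (ν * (Real.log 2 : ℂ)) ^ 2 / (Real.sqrt Real.pi : ℂ) := by
      rw [hdup]
      field_simp
    have hgc' : Complex.Gamma (a + n) = n.factorial * (Complex.Gamma a * ((-1) ^ n * Ring.choose (-a) n)) := by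
      rw [← hgc]; field_simp
    have hsq : ((-1 : ℂ) ^ n) * (-1) ^ n = 1 := by rw [← mul_pow]; simp
    generalize Complex.exp (-(2 * a * (Real.log s : ℂ))) = X
    generalize (((1 / s ^ 2 : ℝ) : ℂ)) ^ n = Y
    calc _ = (Complex.exp (ν * (Real.log 2 : ℂ)))⁻¹ * ((-1) ^ n / (n.factorial * Complex.Gamma (ν + n + 1))) * (X * Y) * ((1 / 4 : ℂ) ^ n * Complex.Gamma (2 * ν + 2 * n + 1)) := by ring
      _ = _ := by
        rw [hdup', hgc']
        field_simp
        linear_combination (X * Y * Complex.Gamma a * Ring.choose (-a) n) * hsq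
  · rw [mul_assoc]
    congr 1
    have hb : (0 : ℝ) < 1 + 1 / s ^ 2 := by positivity
    rw [show (s : ℂ) ^ 2 + 1 = ((s ^ 2 + 1 : ℝ) : ℂ) by push_cast; ring,
      show (1 : ℂ) + ((1 / s ^ 2 : ℝ) : ℂ) = ((1 + 1 / s ^ 2 : ℝ) : ℂ) by push_cast; ring,
      Complex.cpow_def_of_ne_zero (by exact_mod_cast (by positivity : (0 : ℝ) < s ^ 2 + 1).ne'),
      Complex.cpow_def_of_ne_zero (by exact_mod_cast hb.ne'),
      ← Complex.exp_add, ← Complex.ofReal_log hb.le, ← Complex.ofReal_log (by positivity)]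
    congr 1
    rw [show s ^ 2 + 1 = s ^ 2 * (1 + 1 / s ^ 2) by field_simp, Real.log_mul (by positivity) hb.ne',
      Real.log_pow]
    push_cast
    ring

/-! ### Laplace transform: closed form -/

lemma fact_bound (n : ℕ) : ((2 * n).factorial : ℝ) ≤ 4 ^ n * (n.factorial * n.factorial) := by
  have h1 := Nat.choose_mul_factorial_mul_factorial (show n ≤ 2 * n by omega)
  have h2 := Nat.choose_le_two_pow (2 * n) n
  rw [show 2 * n - n = n by omega] at h1
  have h3 : (2 * n).factorial ≤ 4 ^ n * (n.factorial * n.factorial) := by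
    rw [← h1, mul_assoc, show (4 : ℕ) = 2 ^ 2 by norm_num, ← pow_mul]
    exact Nat.mul_le_mul_right _ h2
  exact_mod_cast h3

/-- `x^ν J_ν(x)`. -/
def fJ (ν : ℂ) (x : ℝ) : ℂ := Complex.exp (ν * (Real.log x : ℂ)) * besselJ ν x

lemma norm_exp_im (ν : ℂ) (hν : ν.re = 0) (y : ℝ) : ‖Complex.exp (ν * (y : ℂ))‖ = 1 := by
  rw [Complex.norm_exp]; simp [hν]

lemma real_coeff (ν : ℂ) (hν : ν.re = 0) : (1 / 4 - ν ^ 2 : ℂ) = ((1 / 4 + ν.im ^ 2 : ℝ) : ℂ) := by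
  have : ν = Complex.I * ν.im := by
    apply Complex.ext <;> simp [hν]
  conv_lhs => rw [this]
  push_cast
  rw [mul_pow, Complex.I_sq]
  ring

lemma besselJ_bdd (ν : ℂ) (hν : ν.re = 0) : ∃ C, ∀ x : ℝ, 0 < x → ‖besselJ ν x‖ ≤ C := by
  obtain ⟨C1, h1⟩ := besselJ_bdd_small ν hν
  obtain ⟨u, u1, hu, hd, hd1⟩ := besselJ_ode ν hν
  rw [real_coeff ν hν] at hd1
  obtain ⟨C2, _, h2⟩ := ode_bdd _ (by positivity) u u1 hd hd1
  refine ⟨max C1 C2, fun x hx => ?_⟩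
  rcases le_total x 1 with h | h
  · exact (h1 x hx h).trans (le_max_left _ _)
  · refine le_trans ?_ (le_max_right _ _)
    refine le_trans ?_ (h2 x h).1
    rw [hu x hx, norm_mul, Complex.norm_real, Real.norm_of_nonneg (Real.sqrt_nonneg _)]
    exact le_mul_of_one_le_left (norm_nonneg _) (Real.one_le_sqrt.2 h)

lemma fJ_bdd (ν : ℂ) (hν : ν.re = 0) : ∃ C, ∀ x : ℝ, 0 < x → ‖fJ ν x‖ ≤ C := by
  obtain ⟨C, h⟩ := besselJ_bdd ν hν
  refine ⟨C, fun x hx => ?_⟩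
  rw [fJ, norm_mul, norm_exp_im ν hν, one_mul]
  exact h x hx

lemma fJ_measurable (ν : ℂ) (hν : ν.re = 0) : Measurable (fJ ν) := by
  have hm : Measurable fun x : ℝ => ((Real.log x : ℝ) : ℂ) := by fun_prop
  exact ((hm.const_mul ν).cexp).mul (besselJ_measurable ν hν.ge)

lemma laplace_real (ν : ℂ) (hν : ν.re = 0) (s : ℝ) (hs : 1 < s) :
    ∫ x in Set.Ioi (0 : ℝ), fJ ν x * Complex.exp (-((s : ℂ) * x)) =
      Complex.exp (ν * (Real.log 2 : ℂ)) * Complex.Gamma (ν + 1 / 2) / (Real.sqrt Real.pi : ℂ) *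
        ((s : ℂ) ^ 2 + 1) ^ (-(ν + 1 / 2)) := by
  have hs0 : 0 < s := by linarith
  set F : ℕ → ℝ → ℂ := fun n x => (Complex.exp (-(ν * (Real.log 2 : ℂ))) * bC ν n * (1 / 4) ^ n) *
    ((x : ℂ) ^ ((2 * ν + 2 * n + 1) - 1) * Complex.exp (-((s : ℂ) * x))) with hF
  set G := ‖(Complex.Gamma (ν + 1))⁻¹‖ with hG
  have hcn : ∀ n : ℕ, ‖Complex.exp (-(ν * (Real.log 2 : ℂ))) * bC ν n * (1 / 4) ^ n‖ * ((2 * n).factorial : ℝ) ≤ G := by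
    intro n
    rw [norm_mul, norm_mul, show -(ν * (Real.log 2 : ℂ)) = ν * ((-Real.log 2 : ℝ) : ℂ) by push_cast; ring,
      norm_exp_im ν hν, one_mul, norm_pow]
    have h := bC_bound ν hν.ge n
    have hf : (0 : ℝ) < (n.factorial : ℝ) * n.factorial := by positivity
    calc ‖bC ν n‖ * ‖(1 / 4 : ℂ)‖ ^ n * ((2 * n).factorial : ℝ)
        ≤ (G / ((n.factorial : ℝ) * n.factorial)) * (1 / 4) ^ n * (4 ^ n * (n.factorial * n.factorial)) := by
          gcongr
          · norm_num
          · exact fact_bound n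
      _ = G := by
          rw [div_pow, one_pow]
          field_simp
  have hnorm : ∀ (n : ℕ) (x : ℝ), 0 < x → ‖F n x‖ =
      ‖Complex.exp (-(ν * (Real.log 2 : ℂ))) * bC ν n * (1 / 4) ^ n‖ *
        (x ^ (((2 * n : ℕ) : ℝ) + 1 - 1) * Real.exp (-(s * x))) := by
    intro n x hx
    simp only [hF]
    rw [norm_mul, norm_mul (_ ^ _), Complex.norm_cpow_eq_rpow_re_of_pos hx, Complex.norm_exp]
    congr 3
    · simp [hν]
    · simp
  have hintg : ∀ n : ℕ, Integrable (F n) (volume.restrict (Set.Ioi 0)) := by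
    intro n
    have hi := (integrable_rpow_exp (((2 * n : ℕ) : ℝ) + 1 - 1) s (by
      have : (0 : ℝ) ≤ ((2 * n : ℕ) : ℝ) := Nat.cast_nonneg _
      linarith) hs0).const_mul (‖Complex.exp (-(ν * (Real.log 2 : ℂ))) * bC ν n * (1 / 4) ^ n‖)
    refine hi.mono' ?_ ?_
    · have : Measurable (F n) := by
        simp only [hF]
        fun_prop
      exact this.aestronglyMeasurable
    · exact (ae_restrict_iff' measurableSet_Ioi).2 (Eventually.of_forall fun x hx => (hnorm n x hx).le)
  have hin : ∀ n : ℕ, ∫ x in Set.Ioi (0 : ℝ), ‖F n x‖ ≤ G * (1 / s) * ((1 / s) ^ 2) ^ n := by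
    intro n
    rw [setIntegral_congr_fun measurableSet_Ioi (fun x hx => hnorm n x hx), integral_const_mul,
      Real.integral_rpow_mul_exp_neg_mul_Ioi (by positivity) hs0, Real.Gamma_nat_eq_factorial]
    have e : (1 / s) ^ (((2 * n : ℕ) : ℝ) + 1) = (1 / s) * ((1 / s) ^ 2) ^ n := by
      rw [← pow_mul, ← pow_succ']
      exact_mod_cast Real.rpow_natCast (1 / s) (2 * n + 1)
    rw [e]
    have := hcn n
    have h0 : 0 ≤ (1 / s) * ((1 / s) ^ 2) ^ n := by positivity
    nlinarith
  have hsum : Summable fun n : ℕ => ∫ x in Set.Ioi (0 : ℝ), ‖F n x‖ := by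
    refine Summable.of_nonneg_of_le (fun n => integral_nonneg fun x => norm_nonneg _) hin ?_
    refine (summable_geometric_of_lt_one (by positivity) ?_).mul_left _
    rw [div_pow, one_pow, div_lt_one (by positivity)]
    nlinarith
  have hA := hasSum_integral_of_summable_integral_norm hintg hsum
  have hB := laplace_term_sum ν hν s hs
  have hterm : ∀ n, ∫ x in Set.Ioi (0 : ℝ), F n x = Complex.exp (-(ν * (Real.log 2 : ℂ))) * bC ν n * (1 / 4) ^ n *
      ((1 / (s : ℂ)) ^ (2 * ν + 2 * n + 1) * Complex.Gamma (2 * ν + 2 * n + 1)) := by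
    intro n
    simp only [hF]
    rw [integral_const_mul, Complex.integral_cpow_mul_exp_neg_mul_Ioi]
    · simp [hν]; positivity
    · simpa using hs0
  rw [funext hterm] at hA
  rw [hB.unique hA]
  refine setIntegral_congr_fun measurableSet_Ioi fun x hx => ?_
  have hx0 : 0 < x := hx
  have hxc : (x : ℂ) ≠ 0 := by exact_mod_cast hx0.ne'
  simp only [hF]
  rw [fJ, besselJ_eq_of_pos ν x hx0, bE, ← tsum_mul_left, ← tsum_mul_left, ← tsum_mul_right]
  refine tsum_congr fun n => ?_
  have e1 : (x : ℂ) ^ ((2 * ν + 2 * n + 1) - 1) = Complex.exp (ν * (Real.log x : ℂ)) * Complex.exp (ν * (Real.log x : ℂ)) * ((x : ℂ) ^ 2) ^ n := by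
    rw [show (2 * ν + 2 * n + 1) - 1 = ν + ν + ((2 * n : ℕ) : ℂ) by push_cast; ring, Complex.cpow_add _ _ hxc,
      Complex.cpow_natCast, pow_mul, Complex.cpow_add _ _ hxc, Complex.cpow_def_of_ne_zero hxc, ← Complex.ofReal_log hx0.le, mul_comm ν]
  have e2 : Complex.exp (ν * (Real.log (x / 2) : ℂ)) = Complex.exp (ν * (Real.log x : ℂ)) * Complex.exp (-(ν * (Real.log 2 : ℂ))) := by
    rw [← Complex.exp_add, Real.log_div hx0.ne' two_ne_zero]
    congr 1
    push_cast
    ring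
  rw [e1, e2, div_pow, div_pow, one_pow]
  ring

lemma tendsto_two : Tendsto (fun n : ℕ => ((2 + 1 / ((n : ℝ) + 1) : ℝ) : ℂ)) atTop (nhdsWithin (2 : ℂ) {2}ᶜ) := by
  rw [tendsto_nhdsWithin_iff]
  constructor
  · have : Tendsto (fun n : ℕ => (2 + 1 / ((n : ℝ) + 1) : ℝ)) atTop (nhds (2 + 0)) :=
      tendsto_const_nhds.add tendsto_one_div_add_atTop_nhds_zero_nat
    have h2 := (Complex.continuous_ofReal.tendsto _).comp this
    simpa [Function.comp_def] using h2
  · refine Eventually.of_forall fun n => ?_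
    have : (0 : ℝ) < 1 / ((n : ℝ) + 1) := by positivity
    simp only [Set.mem_compl_iff, Set.mem_singleton_iff]
    intro h
    have h3 := congrArg Complex.re h
    rw [Complex.ofReal_re] at h3
    simp only [Complex.re_ofNat] at h3
    linarith

/-- The closed form on the half plane. -/
lemma laplace_closed (ν : ℂ) (hν : ν.re = 0) (s : ℂ) (hs : 0 < s.re) :
    ∫ x in Set.Ioi (0 : ℝ), fJ ν x * Complex.exp (-(s * x)) =
      Complex.exp (ν * (Real.log 2 : ℂ)) * Complex.Gamma (ν + 1 / 2) / (Real.sqrt Real.pi : ℂ) *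
        (s ^ 2 + 1) ^ (-(ν + 1 / 2)) := by
  have ho : IsOpen {s : ℂ | 0 < s.re} := isOpen_lt continuous_const Complex.continuous_re
  obtain ⟨C, hC⟩ := fJ_bdd ν hν
  have hA := (laplace_differentiableOn (fJ ν) (fJ_measurable ν hν).aestronglyMeasurable C 0 (by norm_num) (by simpa using hC)).analyticOnNhd ho
  have hB : DifferentiableOn ℂ (fun s : ℂ => Complex.exp (ν * (Real.log 2 : ℂ)) * Complex.Gamma (ν + 1 / 2) / (Real.sqrt Real.pi : ℂ) *
        (s ^ 2 + 1) ^ (-(ν + 1 / 2))) {s : ℂ | 0 < s.re} := by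
    intro z hz
    have hz' : 0 < z.re := hz
    refine DifferentiableAt.differentiableWithinAt ?_
    refine DifferentiableAt.const_mul ?_ _
    refine DifferentiableAt.cpow (by fun_prop) (by fun_prop) ?_
    rw [Complex.mem_slitPlane_iff]
    by_cases him : z.im = 0
    · left
      simp [pow_two, him]
      positivity
    · right
      simp [pow_two]
      have := mul_ne_zero hz'.ne' him
      intro h
      apply this
      linarith
  refine hA.eqOn_of_preconnected_of_frequently_eq (hB.analyticOnNhd ho)
    (convex_halfSpace_re_gt 0).isPreconnected (z₀ := 2) (by simp) ?_ hs
  refine tendsto_two.frequently (Frequently.of_forall fun n => ?_)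
  have : (0 : ℝ) < 1 / ((n : ℝ) + 1) := by positivity
  exact laplace_real ν hν _ (by linarith)

/-! ### The connection coefficient -/

lemma laplace_bounded (h : ℝ → ℂ) (hm : Measurable h) (B : ℝ)
    (h0 : ∀ x : ℝ, 0 < x → x ≤ 1 → ‖h x‖ ≤ B * x ^ (-(1 / 2) : ℝ))
    (h1 : ∀ x : ℝ, 1 < x → ‖h x‖ ≤ B * x ^ (-(3 / 2) : ℝ)) :
    ∃ B' : ℝ, ∀ s : ℂ, 0 ≤ s.re →
      IntegrableOn (fun x : ℝ => h x * Complex.exp (-(s * x))) (Set.Ioi 0) ∧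
      ‖∫ x in Set.Ioi (0 : ℝ), h x * Complex.exp (-(s * x))‖ ≤ B' := by
  have hi : IntegrableOn (fun x => ‖h x‖) (Set.Ioi 0) := by
    rw [← Set.Ioc_union_Ioi_eq_Ioi (zero_le_one (α := ℝ))]
    refine IntegrableOn.union ?_ ?_
    · have : IntegrableOn (fun x : ℝ => B * x ^ (-(1 / 2) : ℝ)) (Set.Ioc 0 1) := by
        refine Integrable.const_mul ?_ _
        have := intervalIntegral.intervalIntegrable_rpow' (a := 0) (b := 1) (r := -(1 / 2)) (by norm_num)
        rwa [intervalIntegrable_iff_integrableOn_Ioc_of_le zero_le_one] at this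
      refine this.mono' hm.norm.aestronglyMeasurable ?_
      refine (ae_restrict_iff' measurableSet_Ioc).2 (Eventually.of_forall fun x hx => ?_)
      rw [norm_norm]; exact h0 x hx.1 hx.2
    · have : IntegrableOn (fun x : ℝ => B * x ^ (-(3 / 2) : ℝ)) (Set.Ioi 1) :=
        (integrableOn_Ioi_rpow_of_lt (by norm_num) one_pos).const_mul _
      refine this.mono' hm.norm.aestronglyMeasurable ?_
      refine (ae_restrict_iff' measurableSet_Ioi).2 (Eventually.of_forall fun x hx => ?_)
      rw [norm_norm]; exact h1 x hx
  have hb : ∀ s : ℂ, 0 ≤ s.re → ∀ᵐ x ∂(volume.restrict (Set.Ioi (0 : ℝ))),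
      ‖h x * Complex.exp (-(s * x))‖ ≤ ‖h x‖ := by
    intro s hs
    refine (ae_restrict_iff' measurableSet_Ioi).2 (Eventually.of_forall fun x hx => ?_)
    have hx0 : 0 < x := hx
    rw [norm_mul, Complex.norm_exp]
    refine mul_le_of_le_one_right (norm_nonneg _) ?_
    rw [Real.exp_le_one_iff]
    simp
    positivity
  refine ⟨∫ x in Set.Ioi (0 : ℝ), ‖h x‖, fun s hs => ⟨?_, ?_⟩⟩
  · refine hi.mono' ?_ (hb s hs)
    exact (hm.mul (by fun_prop)).aestronglyMeasurable
  · exact norm_integral_le_of_norm_le hi (hb s hs)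

lemma gamma_cplx (a : ℂ) (ha : 0 < a.re) {r : ℂ} (hr : 0 < r.re) :
    ∫ x in Set.Ioi (0 : ℝ), (x : ℂ) ^ (a - 1) * Complex.exp (-(r * x)) = (1 / r) ^ a * Complex.Gamma a := by
  have ho : IsOpen {s : ℂ | 0 < s.re} := isOpen_lt continuous_const Complex.continuous_re
  have hm : Measurable fun x : ℝ => (x : ℂ) ^ (a - 1) := by fun_prop
  have hA := (laplace_differentiableOn (fun x : ℝ => (x : ℂ) ^ (a - 1)) hm.aestronglyMeasurable 1 (a.re - 1)
    (by linarith) (fun x hx => by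
      rw [Complex.norm_cpow_eq_rpow_re_of_pos hx, one_mul]; simp)).analyticOnNhd ho
  have hB : DifferentiableOn ℂ (fun s : ℂ => (1 / s) ^ a * Complex.Gamma a) {s : ℂ | 0 < s.re} := by
    intro z hz
    have hz' : 0 < z.re := hz
    have hz0 : z ≠ 0 := by
      intro h; rw [h] at hz'; simp at hz'
    refine DifferentiableAt.differentiableWithinAt ?_
    refine DifferentiableAt.mul_const ?_ _
    refine DifferentiableAt.cpow (by fun_prop (disch := exact hz0)) (by fun_prop) ?_
    rw [Complex.mem_slitPlane_iff]
    left
    rw [one_div, Complex.inv_re]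
    have := Complex.normSq_pos.2 hz0
    positivity
  refine hA.eqOn_of_preconnected_of_frequently_eq (hB.analyticOnNhd ho)
    (convex_halfSpace_re_gt 0).isPreconnected (z₀ := 2) (by simp) ?_ hr
  refine tendsto_two.frequently (Frequently.of_forall fun n => ?_)
  exact Complex.integral_cpow_mul_exp_neg_mul_Ioi ha (by positivity)

lemma coef_L (ν : ℂ) (hν : ν.re = 0) (u u1 : ℝ → ℂ)
    (hu : ∀ x : ℝ, 0 < x → u x = (Real.sqrt x : ℂ) * besselJ ν x)
    (L M : ℂ) (C : ℝ) (hC : 0 ≤ C)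
    (hL : ∀ x : ℝ, 1 ≤ x → ‖u1 x - Complex.I * u x - L * Complex.exp (-(Complex.I * x))‖ ≤ C / x)
    (hM : ∀ x : ℝ, 1 ≤ x → ‖u1 x - (-Complex.I) * u x - M * Complex.exp (-((-Complex.I) * x))‖ ≤ C / x) :
    L = -(2 * Complex.I) * (Complex.exp (ν * (Real.log 2 : ℂ)) / (Real.sqrt Real.pi : ℂ)) *
      (-(2 * Complex.I)) ^ (-(ν + 1 / 2)) := by
  set a : ℂ := ν + 1 / 2 with ha
  have hare : a.re = 1 / 2 := by simp [ha, hν]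
  have ha0 : 0 < a.re := by rw [hare]; norm_num
  have hGa : Complex.Gamma a ≠ 0 := Complex.Gamma_ne_zero_of_re_pos ha0
  set W : ℝ → ℂ := fun x => (M * Complex.exp (-((-Complex.I) * x)) - L * Complex.exp (-(Complex.I * x))) / (2 * Complex.I) with hW
  set h : ℝ → ℂ := fun x => fJ ν x - (x : ℂ) ^ (a - 1) * W x with hh
  have hm : Measurable h := by
    refine (fJ_measurable ν hν).sub ?_
    simp only [hW]
    fun_prop
  have hcn : ∀ x : ℝ, 0 < x → ‖(x : ℂ) ^ (a - 1)‖ = x ^ (-(1 / 2) : ℝ) := by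
    intro x hx
    rw [Complex.norm_cpow_eq_rpow_re_of_pos hx]
    congr 1
    simp [hare]; norm_num
  have hfu : ∀ x : ℝ, 0 < x → fJ ν x = (x : ℂ) ^ (a - 1) * u x := by
    intro x hx
    have hxc : (x : ℂ) ≠ 0 := by exact_mod_cast hx.ne'
    rw [hu x hx, fJ, ← mul_assoc, Complex.cpow_def_of_ne_zero hxc, ← Complex.ofReal_log hx.le]
    congr 1
    have : (Real.sqrt x : ℂ) = Complex.exp ((Real.log x : ℂ) * (1 / 2)) := by
      rw [Real.sqrt_eq_rpow, Real.rpow_def_of_pos hx]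
      push_cast; rfl
    rw [this, ← Complex.exp_add]
    congr 1
    rw [ha]; ring
  have hWb : ∀ x : ℝ, ‖W x‖ ≤ ‖M‖ + ‖L‖ := by
    intro x
    have e1 : ‖Complex.exp (-((-Complex.I) * x))‖ = 1 := by
      rw [show -((-Complex.I) * (x : ℂ)) = Complex.I * x by ring]; exact norm_exp_im _ (by simp) x
    have e2 : ‖Complex.exp (-(Complex.I * x))‖ = 1 := by
      rw [show -(Complex.I * (x : ℂ)) = (-Complex.I) * x by ring]; exact norm_exp_im _ (by simp) x
    simp only [hW]
    rw [norm_div, norm_mul, Complex.norm_I]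
    have h3 := norm_sub_le (M * Complex.exp (-((-Complex.I) * x))) (L * Complex.exp (-(Complex.I * x)))
    rw [norm_mul, norm_mul, e1, e2, mul_one, mul_one] at h3
    have : (0 : ℝ) ≤ ‖M‖ + ‖L‖ := by positivity
    rw [Complex.norm_ofNat, mul_one, div_le_iff₀ two_pos]
    linarith
  obtain ⟨C0, hC0⟩ := fJ_bdd ν hν
  have hC00 : 0 ≤ C0 := (norm_nonneg _).trans (hC0 1 one_pos)
  obtain ⟨B', hB'⟩ := laplace_bounded h hm (C0 + (‖M‖ + ‖L‖) + C) (by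
    intro x hx hx1
    simp only [hh]
    have h1 : (1 : ℝ) ≤ x ^ (-(1 / 2) : ℝ) := Real.one_le_rpow_of_pos_of_le_one_of_nonpos hx hx1 (by norm_num)
    refine (norm_sub_le _ _).trans ?_
    rw [norm_mul, hcn x hx]
    have h2 := hC0 x hx
    have h3 := hWb x
    have h4 : C0 * 1 ≤ C0 * x ^ (-(1 / 2) : ℝ) := by gcongr
    have h5 : x ^ (-(1 / 2) : ℝ) * ‖W x‖ ≤ x ^ (-(1 / 2) : ℝ) * (‖M‖ + ‖L‖) := by gcongr
    have h6 : 0 ≤ C * x ^ (-(1 / 2) : ℝ) := by positivity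
    nlinarith) (by
    intro x hx
    have hx0 : 0 < x := one_pos.trans hx
    simp only [hh]
    rw [hfu x hx0, ← mul_sub, norm_mul, hcn x hx0]
    have e : u x - W x = ((u1 x - (-Complex.I) * u x - M * Complex.exp (-((-Complex.I) * x))) -
      (u1 x - Complex.I * u x - L * Complex.exp (-(Complex.I * x)))) / (2 * Complex.I) := by
      simp only [hW]
      field_simp
      ring
    have hb : ‖u x - W x‖ ≤ C / x := by
      rw [e, norm_div, norm_mul, Complex.norm_I]
      have h3 := (norm_sub_le _ _).trans (add_le_add (hM x hx.le) (hL x hx.le))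
      norm_num at h3 ⊢
      linarith
    have hp : x ^ (-(1 / 2) : ℝ) * (C / x) = C * x ^ (-(3 / 2) : ℝ) := by
      rw [show (-(3 / 2) : ℝ) = -(1 / 2) - 1 by norm_num, Real.rpow_sub_one hx0.ne']
      ring
    calc x ^ (-(1 / 2) : ℝ) * ‖u x - W x‖ ≤ x ^ (-(1 / 2) : ℝ) * (C / x) := by gcongr
      _ = C * x ^ (-(3 / 2) : ℝ) := hp
      _ ≤ _ := by
        gcongr
        have : (0 : ℝ) ≤ ‖M‖ + ‖L‖ := by positivity
        linarith)
  set K : ℂ := Complex.exp (ν * (Real.log 2 : ℂ)) / (Real.sqrt Real.pi : ℂ) with hK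
  set E : ℝ → ℂ := fun ε => ∫ x in Set.Ioi (0 : ℝ), h x * Complex.exp (-(((ε : ℂ) - Complex.I) * x)) with hE
  have hintg : ∀ r : ℂ, 0 < r.re → IntegrableOn (fun x : ℝ => (x : ℂ) ^ (a - 1) * Complex.exp (-(r * x))) (Set.Ioi 0) := by
    intro r hr
    refine (integrable_rpow_exp (-(1 / 2)) r.re (by norm_num) hr).mono' ?_ ?_
    · have : Measurable fun x : ℝ => (x : ℂ) ^ (a - 1) * Complex.exp (-(r * x)) := by fun_prop
      exact this.aestronglyMeasurable
    · refine (ae_restrict_iff' measurableSet_Ioi).2 (Eventually.of_forall fun x hx => ?_)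
      rw [norm_mul, hcn x hx, Complex.norm_exp]
      simp
  have main : ∀ ε : ℝ, 0 < ε → L / (2 * Complex.I) * Complex.Gamma a = - (K * Complex.Gamma a * ((ε : ℂ) - 2 * Complex.I) ^ (-a)) +
      (ε : ℂ) ^ a * (M / (2 * Complex.I) * ((1 / ((ε : ℂ) - 2 * Complex.I)) ^ a * Complex.Gamma a) + E ε) := by
    intro ε hε
    have hεc : (ε : ℂ) ≠ 0 := by exact_mod_cast hε.ne'
    have hcl := laplace_closed ν hν ((ε : ℂ) - Complex.I) (by simpa using hε)
    have hr2 : 0 < ((ε : ℂ) - 2 * Complex.I).re := by simpa using hε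
    have hr1 : 0 < (ε : ℂ).re := by simpa using hε
    have hi1 := hintg _ hr1
    have hi2 := hintg _ hr2
    have hi3 := (hB' ((ε : ℂ) - Complex.I) (by simpa using hε.le)).1
    have hsplit : ∫ x in Set.Ioi (0 : ℝ), fJ ν x * Complex.exp (-(((ε : ℂ) - Complex.I) * x)) =
        E ε + (M / (2 * Complex.I) * ((1 / ((ε : ℂ) - 2 * Complex.I)) ^ a * Complex.Gamma a) -
          L / (2 * Complex.I) * ((1 / (ε : ℂ)) ^ a * Complex.Gamma a)) := by
      rw [← gamma_cplx a ha0 hr2, ← gamma_cplx a ha0 hr1,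
        ← integral_const_mul, ← integral_const_mul, ← integral_sub (hi2.const_mul _) (hi1.const_mul _),
        hE]
      simp only
      refine Eq.trans ?_ (integral_add hi3 (show IntegrableOn (fun x : ℝ =>
        M / (2 * Complex.I) * ((x : ℂ) ^ (a - 1) * Complex.exp (-(((ε : ℂ) - 2 * Complex.I) * x))) -
        L / (2 * Complex.I) * ((x : ℂ) ^ (a - 1) * Complex.exp (-((ε : ℂ) * x)))) (Set.Ioi 0) volume from
        (hi2.const_mul _).sub (hi1.const_mul _)))
      refine setIntegral_congr_fun measurableSet_Ioi fun x hx => ?_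
      simp only [hh, hW]
      have e1 : Complex.exp (-(((ε : ℂ) - 2 * Complex.I) * x)) = Complex.exp (-((-Complex.I) * x)) * Complex.exp (-(((ε : ℂ) - Complex.I) * x)) := by
        rw [← Complex.exp_add]; congr 1; ring
      have e2 : Complex.exp (-((ε : ℂ) * x)) = Complex.exp (-(Complex.I * x)) * Complex.exp (-(((ε : ℂ) - Complex.I) * x)) := by
        rw [← Complex.exp_add]; congr 1; ring
      rw [e1, e2]
      ring
    rw [hsplit] at hcl
    have hr2ne : ((ε : ℂ) - 2 * Complex.I) ≠ 0 := by
      intro h0; rw [h0] at hr2; simp at hr2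
    have hs1 : ((ε : ℂ) - Complex.I) ^ 2 + 1 = (ε : ℂ) * ((ε : ℂ) - 2 * Complex.I) := by
      linear_combination Complex.I_sq
    have hpow : (((ε : ℂ) - Complex.I) ^ 2 + 1) ^ (-a) = (ε : ℂ) ^ (-a) * ((ε : ℂ) - 2 * Complex.I) ^ (-a) := by
      rw [hs1, Complex.cpow_def_of_ne_zero (mul_ne_zero hεc hr2ne), Complex.cpow_def_of_ne_zero hεc,
        Complex.cpow_def_of_ne_zero hr2ne, ← Complex.exp_add, Complex.log_ofReal_mul hε hr2ne, ← Complex.ofReal_log hε.le]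
      congr 1
      ring
    have h1e : (ε : ℂ) ^ a * (1 / (ε : ℂ)) ^ a = 1 := by
      rw [Complex.cpow_def_of_ne_zero hεc, Complex.cpow_def_of_ne_zero (by simpa using hεc), ← Complex.exp_add,
        one_div, ← Complex.ofReal_inv, ← Complex.ofReal_log hε.le, ← Complex.ofReal_log (by positivity), Real.log_inv]
      push_cast
      rw [Complex.exp_eq_one_iff]
      exact ⟨0, by push_cast; ring⟩
    have h2e : (ε : ℂ) ^ a * (ε : ℂ) ^ (-a) = 1 := by
      rw [← Complex.cpow_add _ _ hεc]; simp
    rw [hpow] at hcl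
    have hcl' : E ε + (M / (2 * Complex.I) * ((1 / ((ε : ℂ) - 2 * Complex.I)) ^ a * Complex.Gamma a) -
          L / (2 * Complex.I) * ((1 / (ε : ℂ)) ^ a * Complex.Gamma a)) = K * Complex.Gamma a * ((ε : ℂ) ^ (-a) * ((ε : ℂ) - 2 * Complex.I) ^ (-a)) := by
      rw [hcl, hK]; ring
    linear_combination (-(ε : ℂ) ^ a) * hcl' - L / (2 * Complex.I) * Complex.Gamma a * h1e - (K * Complex.Gamma a * ((ε : ℂ) - 2 * Complex.I) ^ (-a)) * h2e
  have hsl : (-(2 * Complex.I)) ∈ Complex.slitPlane := by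
    rw [Complex.mem_slitPlane_iff]; right; simp
  have hsl2 : (1 / (-(2 * Complex.I))) ∈ Complex.slitPlane := by
    rw [Complex.mem_slitPlane_iff]; right
    simp
  have tε : Tendsto (fun ε : ℝ => (ε : ℂ) - 2 * Complex.I) (nhdsWithin 0 (Set.Ioi 0)) (nhds (-(2 * Complex.I))) := by
    have : Continuous fun ε : ℝ => (ε : ℂ) - 2 * Complex.I := by fun_prop
    have h2 := this.tendsto 0
    simp only [Complex.ofReal_zero, zero_sub] at h2
    exact h2.mono_left nhdsWithin_le_nhds
  have t1 : Tendsto (fun ε : ℝ => ((ε : ℂ) - 2 * Complex.I) ^ (-a)) (nhdsWithin 0 (Set.Ioi 0)) (nhds ((-(2 * Complex.I)) ^ (-a))) :=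
    tε.cpow tendsto_const_nhds hsl
  have t2 : Tendsto (fun ε : ℝ => (1 / ((ε : ℂ) - 2 * Complex.I)) ^ a) (nhdsWithin 0 (Set.Ioi 0)) (nhds ((1 / (-(2 * Complex.I))) ^ a)) :=
    (tendsto_const_nhds.div tε (by simp)).cpow tendsto_const_nhds hsl2
  have t3 : Tendsto (fun ε : ℝ => (ε : ℂ) ^ a) (nhdsWithin 0 (Set.Ioi 0)) (nhds 0) := by
    rw [tendsto_zero_iff_norm_tendsto_zero]
    have h1 : Tendsto (fun ε : ℝ => ε ^ (1 / 2 : ℝ)) (nhdsWithin 0 (Set.Ioi 0)) (nhds 0) := by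
      have := (Real.continuousAt_rpow_const 0 (1 / 2 : ℝ) (Or.inr (by norm_num))).tendsto
      rw [Real.zero_rpow (by norm_num)] at this
      exact this.mono_left nhdsWithin_le_nhds
    refine h1.congr' ?_
    filter_upwards [self_mem_nhdsWithin] with ε hε
    rw [Complex.norm_cpow_eq_rpow_re_of_pos hε, hare]
  have t4 : Tendsto (fun ε : ℝ => (ε : ℂ) ^ a * E ε) (nhdsWithin 0 (Set.Ioi 0)) (nhds 0) := by
    have h1 := t3.norm.mul_const B'
    rw [norm_zero, zero_mul] at h1
    refine squeeze_zero_norm' ?_ h1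
    filter_upwards [self_mem_nhdsWithin] with ε hε
    rw [norm_mul]
    gcongr
    refine (hB' ((ε : ℂ) - Complex.I) ?_).2
    simpa using (le_of_lt hε)
  have t5 := ((t1.const_mul (K * Complex.Gamma a)).neg).add ((t3.mul ((t2.mul_const (Complex.Gamma a)).const_mul (M / (2 * Complex.I)))).add t4)
  have t6 : Tendsto (fun _ : ℝ => L / (2 * Complex.I) * Complex.Gamma a) (nhdsWithin 0 (Set.Ioi 0)) (nhds (L / (2 * Complex.I) * Complex.Gamma a)) :=
    tendsto_const_nhds
  have hfin := tendsto_nhds_unique t6 (t5.congr' (by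
    filter_upwards [self_mem_nhdsWithin] with ε hε
    rw [main ε hε]
    ring))
  rw [zero_mul, add_zero, add_zero] at hfin
  have : L / (2 * Complex.I) = -(K * (-(2 * Complex.I)) ^ (-a)) := by
    apply mul_right_cancel₀ hGa
    rw [hfin]; ring
  rw [div_eq_iff (by simp)] at this
  rw [this]; ring

/-! ### The Hankel function -/

lemma coef_value (ν : ℂ) : -(2 * Complex.I) * (Complex.exp (ν * (Real.log 2 : ℂ)) / (Real.sqrt Real.pi : ℂ)) *
      (-(2 * Complex.I)) ^ (-(ν + 1 / 2)) = -(2 * Complex.I) / (Real.sqrt Real.pi : ℂ) *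
      Complex.exp (-(Real.log 2 : ℂ) / 2 + Real.pi / 2 * Complex.I * (ν + 1 / 2)) := by
  have hlog : Complex.log (-(2 * Complex.I)) = (Real.log 2 : ℂ) - Real.pi / 2 * Complex.I := by
    rw [show -(2 * Complex.I) = ((2 : ℝ) : ℂ) * (-Complex.I) by push_cast; ring,
      Complex.log_ofReal_mul two_pos (by simp), Complex.log_neg_I]
    ring
  rw [Complex.cpow_def_of_ne_zero (by simp), hlog]
  have : Complex.exp (-(Real.log 2 : ℂ) / 2 + Real.pi / 2 * Complex.I * (ν + 1 / 2)) =
    Complex.exp (ν * (Real.log 2 : ℂ)) * Complex.exp (((Real.log 2 : ℂ) - Real.pi / 2 * Complex.I) * -(ν + 1 / 2)) := by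
    rw [← Complex.exp_add]; congr 1; ring
  rw [this]; ring

lemma besselJ_asymp (ν : ℂ) (hν : ν.re = 0) : ∃ (u u1 : ℝ → ℂ) (C : ℝ), 0 ≤ C ∧
    (∀ x : ℝ, 0 < x → u x = (Real.sqrt x : ℂ) * besselJ ν x) ∧
    (∀ x : ℝ, 0 < x → HasDerivAt u (u1 x) x) ∧
    (∀ x : ℝ, 1 ≤ x → ‖u x‖ ≤ C) ∧
    (∀ x : ℝ, 1 ≤ x → ‖u1 x - Complex.I * u x - (-(2 * Complex.I) / (Real.sqrt Real.pi : ℂ) *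
      Complex.exp (-(Real.log 2 : ℂ) / 2 + Real.pi / 2 * Complex.I * (ν + 1 / 2))) *
        Complex.exp (-(Complex.I * x))‖ ≤ C / x) := by
  obtain ⟨u, u1, hu, hd, hd1⟩ := besselJ_ode ν hν
  rw [real_coeff ν hν] at hd1
  have hc : 0 ≤ 1 / 4 + ν.im ^ 2 := by positivity
  obtain ⟨C0, hC0, h0⟩ := ode_bdd _ hc u u1 hd hd1
  obtain ⟨L, C1, hC1, h1⟩ := ode_asymp _ hc u u1 Complex.I (by simp) (by simp) hd hd1
  obtain ⟨M, C2, hC2, h2⟩ := ode_asymp _ hc u u1 (-Complex.I) (by simp) (by simp) hd hd1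
  have hL := coef_L ν hν u u1 hu L M (C1 + C2) (by positivity)
    (fun x hx => (h1 x hx).trans (by gcongr; linarith)) (fun x hx => (h2 x hx).trans (by gcongr; linarith))
  rw [coef_value] at hL
  refine ⟨u, u1, C0 + C1, by positivity, hu, hd, fun x hx => (h0 x hx).1.trans (by linarith), fun x hx => ?_⟩
  rw [← hL]
  exact (h1 x hx).trans (by gcongr; linarith)

lemma hankel_asymp (ν : ℂ) (hν : ν.re = 0) : ∃ (U U1 : ℝ → ℂ) (C : ℝ), 0 ≤ C ∧
    (∀ x : ℝ, 0 < x → U x = (Real.sqrt x : ℂ) * hankel1 ν x) ∧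
    (∀ x : ℝ, 0 < x → HasDerivAt U (U1 x) x) ∧
    (∀ x : ℝ, 1 ≤ x → ‖U x‖ ≤ C) ∧
    (∀ x : ℝ, 1 ≤ x → ‖U1 x - Complex.I * U x‖ ≤ C / x) ∧
    (∀ x : ℝ, 0 < x → x ≤ 1 → ‖hankel1 ν x‖ ≤ C) := by
  have hν' : (-ν).re = 0 := by simp [hν]
  obtain ⟨u, u1, C1, hC1, hu, hud, hub, hua⟩ := besselJ_asymp ν hν
  obtain ⟨w, w1, C2, hC2, hw, hwd, hwb, hwa⟩ := besselJ_asymp (-ν) hν'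
  obtain ⟨C3, h3⟩ := besselJ_bdd ν hν
  obtain ⟨C4, h4⟩ := besselJ_bdd (-ν) hν'
  have hC3 : 0 ≤ C3 := (norm_nonneg _).trans (h3 1 one_pos)
  have hC4 : 0 ≤ C4 := (norm_nonneg _).trans (h4 1 one_pos)
  set e := Complex.exp (-(Complex.I * (Real.pi : ℂ) * ν)) with he
  set d := Complex.I * Complex.sin (ν * (Real.pi : ℂ)) with hd
  have hbig : ∀ (A B : ℂ) (a b : ℝ), 0 ≤ a → 0 ≤ b → ‖A‖ ≤ a → ‖B‖ ≤ b → ‖(A - e * B) / d‖ ≤ (a + ‖e‖ * b) * ‖d‖⁻¹ := by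
    intro A B a b ha hb hA hB
    rw [div_eq_mul_inv, norm_mul, norm_inv]
    gcongr
    refine (norm_sub_le _ _).trans ?_
    rw [norm_mul]
    gcongr
  refine ⟨fun x => (w x - e * u x) / d, fun x => (w1 x - e * u1 x) / d,
    ((C2 + C4) + ‖e‖ * (C1 + C3)) * ‖d‖⁻¹, by positivity, ?_, ?_, ?_, ?_, ?_⟩
  · intro x hx
    simp only
    rw [hu x hx, hw x hx, hankel1]
    ring
  · intro x hx
    exact ((hwd x hx).sub ((hud x hx).const_mul e)).div_const d
  · intro x hx
    exact hbig _ _ _ _ (by positivity) (by positivity) ((hwb x hx).trans (by linarith)) ((hub x hx).trans (by linarith))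
  · intro x hx
    have hx0 : 0 < x := one_pos.trans_le hx
    have h5 := hbig _ _ ((C2 + C4) / x) ((C1 + C3) / x) (by positivity) (by positivity)
      ((hwa x hx).trans (by gcongr; linarith)) ((hua x hx).trans (by gcongr; linarith))
    have ee : e * Complex.exp (-(Real.log 2 : ℂ) / 2 + Real.pi / 2 * Complex.I * (ν + 1 / 2)) =
      Complex.exp (-(Real.log 2 : ℂ) / 2 + Real.pi / 2 * Complex.I * (-ν + 1 / 2)) := by
      rw [he, ← Complex.exp_add]; congr 1; ring
    rw [← ee] at h5
    refine le_trans (le_of_eq ?_) (h5.trans (le_of_eq ?_))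
    · congr 1
      ring
    · ring
  · intro x hx _
    rw [hankel1]
    exact hbig _ _ _ _ (by positivity) (by positivity) ((h4 x hx).trans (by linarith)) ((h3 x hx).trans (by linarith))

/-! ### Decay of the Fourier transform of the potential -/

lemma pot_bound (W : ℝ × V3 → ℂ) (hW : ContDiff ℝ (⊤ : ℕ∞) W) (hWc : HasCompactSupport W) (j : ℕ) :
    ∃ b : V3 → ℝ, Integrable b ∧ (∀ x, 0 ≤ b x) ∧ ∀ (s : ℝ) (x : V3), ‖iteratedFDeriv ℝ j W (s, x)‖ ≤ b x := by
  have hcont : Continuous (iteratedFDeriv ℝ j W) := hW.continuous_iteratedFDeriv (by exact_mod_cast le_top)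
  have hcs : HasCompactSupport (iteratedFDeriv ℝ j W) := hWc.iteratedFDeriv j
  obtain ⟨M, hM⟩ := hcs.exists_bound_of_continuous hcont
  have hM0 : 0 ≤ M := (norm_nonneg _).trans (hM 0)
  have hK : IsCompact (Prod.snd '' tsupport (iteratedFDeriv ℝ j W)) := hcs.isCompact.image continuous_snd
  set K := Prod.snd '' tsupport (iteratedFDeriv ℝ j W) with hKd
  refine ⟨K.indicator fun _ => M, ?_, fun x => Set.indicator_nonneg (fun _ _ => hM0) x, fun s x => ?_⟩
  · rw [integrable_indicator_iff hK.measurableSet]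
    exact integrableOn_const (hs := hK.measure_lt_top.ne)
  · by_cases hx : x ∈ K
    · rw [Set.indicator_of_mem hx]; exact hM _
    · rw [Set.indicator_of_notMem hx]
      have : iteratedFDeriv ℝ j W (s, x) = 0 := by
        by_contra h
        exact hx ⟨(s, x), subset_tsupport _ h, rfl⟩
      rw [this, norm_zero]

lemma slice_contDiff (W : ℝ × V3 → ℂ) (hW : ContDiff ℝ (⊤ : ℕ∞) W) (s : ℝ) :
    ContDiff ℝ (⊤ : ℕ∞) fun x : V3 => W (s, x) := hW.comp (contDiff_const.prodMk contDiff_id)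

lemma slice_deriv (W : ℝ × V3 → ℂ) (hW : ContDiff ℝ (⊤ : ℕ∞) W) (s : ℝ) (j : ℕ) (x : V3) :
    ‖iteratedFDeriv ℝ j (fun x : V3 => W (s, x)) x‖ ≤ ‖iteratedFDeriv ℝ j W (s, x)‖ := by
  have h1 : (fun x : V3 => W (s, x)) = (fun y : ℝ × V3 => W ((s, 0) + y)) ∘ (ContinuousLinearMap.inr ℝ ℝ V3) := by
    funext x; simp
  have hc : ContDiff ℝ (⊤ : ℕ∞) (fun y : ℝ × V3 => W ((s, 0) + y)) := hW.comp (contDiff_const.add contDiff_id)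
  rw [h1, ContinuousLinearMap.iteratedFDeriv_comp_right _ hc x (by exact_mod_cast le_top), iteratedFDeriv_comp_add_left]
  refine (ContinuousMultilinearMap.norm_compContinuousLinearMap_le _ _).trans ?_
  have : ((s, (0 : V3)) + (ContinuousLinearMap.inr ℝ ℝ V3) x) = (s, x) := by simp
  rw [this]
  refine mul_le_of_le_one_right (norm_nonneg _) ?_
  refine Finset.prod_le_one (fun _ _ => norm_nonneg _) fun _ _ => ?_
  exact ContinuousLinearMap.norm_inr_le_one ℝ ℝ V3

lemma fourier_decay (W : ℝ × V3 → ℂ) (hW : ContDiff ℝ (⊤ : ℕ∞) W) (hWc : HasCompactSupport W) (n : ℕ) :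
    ∃ C, ∀ (s : ℝ) (w : V3), ‖w‖ ^ n * ‖FourierTransform.fourier (fun x : V3 => W (s, x)) w‖ ≤ C := by
  choose b hbi hb0 hb using pot_bound W hW hWc
  have hle : ∀ s j x, ‖iteratedFDeriv ℝ j (fun x : V3 => W (s, x)) x‖ ≤ b j x := fun s j x =>
    (slice_deriv W hW s j x).trans (hb j s x)
  have hintg : ∀ s j, Integrable fun x => ‖iteratedFDeriv ℝ j (fun x : V3 => W (s, x)) x‖ := by
    intro s j
    refine (hbi j).mono' ?_ (Eventually.of_forall fun x => ?_)
    · exact ((slice_contDiff W hW s).continuous_iteratedFDeriv (by exact_mod_cast le_top)).norm.aestronglyMeasurable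
    · rw [norm_norm]; exact hle s j x
  refine ⟨(2 * Real.pi) ^ 0 * (2 * ((0 : ℕ) : ℝ) + 2) ^ n *
    ∑ p ∈ Finset.range (0 + 1) ×ˢ Finset.range (n + 1), ∫ v : V3, b p.2 v, fun s w => ?_⟩
  have h := Real.pow_mul_norm_iteratedFDeriv_fourier_le (K := 0) (N := ⊤) (slice_contDiff W hW s) (by
    intro k m hk _
    have : k = 0 := by simpa using hk
    subst this
    simpa using hintg s m) (k := 0) (n := n) (by simp) le_top w
  rw [norm_iteratedFDeriv_zero] at h
  refine h.trans ?_
  gcongr with p hp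
  · have : p.1 = 0 := by
      have := (Finset.mem_product.1 hp).1
      simpa using this
    rw [this]
    simpa using hintg s p.2
  · exact hbi p.2
  · intro v
    have : p.1 = 0 := by
      have := (Finset.mem_product.1 hp).1
      simpa using this
    simp only [this, pow_zero, one_mul]
    exact hle s p.2 v

lemma ft_eq_fourier (g : V3 → ℂ) (k : V3) : ft g k = (((2 * Real.pi) ^ (-(3 : ℝ) / 2) : ℝ) : ℂ) *
    FourierTransform.fourier g ((2 * Real.pi)⁻¹ • k) := by
  rw [ft, Real.fourier_eq']
  congr 2
  funext x
  rw [smul_eq_mul]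
  congr 2
  rw [real_inner_smul_right, real_inner_comm x k]
  push_cast
  have : (Real.pi : ℂ) ≠ 0 := by exact_mod_cast Real.pi_ne_zero
  field_simp

lemma ft_decay (W : ℝ × V3 → ℂ) (hW : ContDiff ℝ (⊤ : ℕ∞) W) (hWc : HasCompactSupport W) :
    ∃ C, 0 ≤ C ∧ ∀ (s : ℝ) (k : V3), ‖ft (fun x : V3 => W (s, x)) k‖ * (1 + ‖k‖) ^ 4 ≤ C := by
  obtain ⟨C0, h0⟩ := fourier_decay W hW hWc 0
  obtain ⟨C4, h4⟩ := fourier_decay W hW hWc 4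
  have hC0 : 0 ≤ C0 := le_trans (by positivity) (h0 0 0)
  have hC4 : 0 ≤ C4 := le_trans (by positivity) (h4 0 0)
  have hc : 0 ≤ (2 * Real.pi) ^ (-(3 : ℝ) / 2) := by positivity
  refine ⟨(2 * Real.pi) ^ (-(3 : ℝ) / 2) * (8 * (C0 + (2 * Real.pi) ^ 4 * C4)), by positivity, fun s k => ?_⟩
  rw [ft_eq_fourier, norm_mul, Complex.norm_real, Real.norm_of_nonneg hc, mul_assoc]
  refine mul_le_mul_of_nonneg_left ?_ hc
  have a0 := h0 s ((2 * Real.pi)⁻¹ • k)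
  have a4 := h4 s ((2 * Real.pi)⁻¹ • k)
  have hk : ‖(2 * Real.pi)⁻¹ • k‖ = (2 * Real.pi)⁻¹ * ‖k‖ := by
    rw [norm_smul, Real.norm_of_nonneg (by positivity)]
  rw [hk] at a4
  rw [pow_zero, one_mul] at a0
  set N := ‖FourierTransform.fourier (fun x : V3 => W (s, x)) ((2 * Real.pi)⁻¹ • k)‖
  have hN : 0 ≤ N := norm_nonneg _
  have a4' : ‖k‖ ^ 4 * N ≤ (2 * Real.pi) ^ 4 * C4 := by
    have := mul_le_mul_of_nonneg_left a4 (by positivity : 0 ≤ (2 * Real.pi) ^ 4)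
    refine le_trans (le_of_eq ?_) this
    have : Real.pi ≠ 0 := Real.pi_ne_zero
    field_simp
  have hp : (1 + ‖k‖) ^ 4 ≤ 8 * (1 + ‖k‖ ^ 4) := by
    have hy : 0 ≤ ‖k‖ := norm_nonneg _
    nlinarith [sq_nonneg (1 - ‖k‖), sq_nonneg (1 - ‖k‖ ^ 2), mul_nonneg hy (sq_nonneg (1 - ‖k‖)), mul_nonneg (mul_nonneg hy hy) (sq_nonneg (1 - ‖k‖))]
  calc N * (1 + ‖k‖) ^ 4 ≤ N * (8 * (1 + ‖k‖ ^ 4)) := by gcongr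
    _ = 8 * (N + ‖k‖ ^ 4 * N) := by ring
    _ ≤ _ := by gcongr

lemma ft_hasDerivAt (W : ℝ × V3 → ℂ) (hW : ContDiff ℝ (⊤ : ℕ∞) W) (hWc : HasCompactSupport W) (k : V3) (s0 : ℝ) :
    HasDerivAt (fun s : ℝ => ft (fun x : V3 => W (s, x)) k)
      (ft (fun x : V3 => fderiv ℝ W (s0, x) (1, 0)) k) s0 := by
  obtain ⟨b0, hb0i, _, hb0⟩ := pot_bound W hW hWc 0
  have hDc : HasCompactSupport fun y => fderiv ℝ W y ((1 : ℝ), (0 : V3)) := hWc.fderiv_apply (𝕜 := ℝ) _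
  have hD : ContDiff ℝ (⊤ : ℕ∞) fun y => fderiv ℝ W y ((1 : ℝ), (0 : V3)) :=
    (hW.fderiv_right (m := ((⊤ : ℕ∞) : WithTop ℕ∞)) (by exact_mod_cast le_top)).clm_apply contDiff_const
  obtain ⟨b1, hb1i, _, hb1⟩ := pot_bound _ hD hDc 0
  simp only [norm_iteratedFDeriv_zero] at hb0 hb1
  have hexp : ∀ x : V3, ‖Complex.exp (-(Complex.I) * (⟪k, x⟫ : ℂ))‖ = 1 := fun x => norm_exp_im _ (by simp) _
  have hec : Continuous fun x : V3 => Complex.exp (-(Complex.I) * (⟪k, x⟫ : ℂ)) := by fun_prop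
  unfold ft
  refine HasDerivAt.const_mul _ ?_
  refine (hasDerivAt_integral_of_dominated_loc_of_deriv_le (s := Set.univ) (bound := b1)
    (F := fun (s : ℝ) (x : V3) => Complex.exp (-(Complex.I) * (⟪k, x⟫ : ℂ)) * W (s, x))
    (F' := fun (s : ℝ) (x : V3) => Complex.exp (-(Complex.I) * (⟪k, x⟫ : ℂ)) * fderiv ℝ W (s, x) (1, 0))
    Filter.univ_mem ?_ ?_ ?_ ?_ hb1i ?_).2
  · exact Eventually.of_forall fun s => (hec.mul (slice_contDiff W hW s).continuous).aestronglyMeasurable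
  · refine hb0i.mono' (hec.mul (slice_contDiff W hW s0).continuous).aestronglyMeasurable (Eventually.of_forall fun x => ?_)
    rw [norm_mul, hexp, one_mul]; exact hb0 _ _
  · exact (hec.mul (slice_contDiff _ hD s0).continuous).aestronglyMeasurable
  · refine Eventually.of_forall fun x s _ => ?_
    rw [norm_mul, hexp, one_mul]; exact hb1 _ _
  · refine Eventually.of_forall fun x s _ => ?_
    refine HasDerivAt.const_mul _ ?_
    have h1 : HasFDerivAt W (fderiv ℝ W (s, x)) (s, x) := (hW.differentiable (by simp) _).hasFDerivAt
    exact h1.comp_hasDerivAt s ((hasDerivAt_id s).prodMk (hasDerivAt_const s x))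

lemma ft_measurable (W : ℝ × V3 → ℂ) (hW : Continuous W) :
    Measurable fun y : ℝ × V3 => ft (fun x : V3 => W (y.1, x)) y.2 := by
  unfold ft
  refine Measurable.const_mul ?_ _
  have : Continuous fun z : (ℝ × V3) × V3 => Complex.exp (-(Complex.I) * (⟪z.1.2, z.2⟫ : ℂ)) * W (z.1.1, z.2) := by
    fun_prop
  exact (this.stronglyMeasurable.integral_prod_right').measurable

lemma hankel1_measurable (ν : ℂ) (hν : ν.re = 0) : Measurable (hankel1 ν) := by
  unfold hankel1
  have h1 : Measurable (besselJ ν) := besselJ_measurable ν hν.ge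
  have h2 : Measurable (besselJ (-ν)) := besselJ_measurable (-ν) (by simp [hν])
  exact (h2.sub (h1.const_mul _)).div_const _

lemma modeNu_re (m R : ℝ) : (modeNu m R).re = 0 := by simp [modeNu]

lemma modeV_measurable (m R : ℝ) : Measurable fun y : ℝ × ℝ => modeV m R y.1 y.2 := by
  unfold modeV
  have h := hankel1_measurable _ (modeNu_re m R)
  have h1 : Measurable fun y : ℝ × ℝ => hankel1 (modeNu m R) (y.2 * y.1) :=
    h.comp (measurable_snd.mul measurable_fst)
  have h2 : Measurable fun y : ℝ × ℝ => ((y.1 ^ ((3 : ℝ) / 2) : ℝ) : ℂ) :=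
    Complex.measurable_ofReal.comp (measurable_fst.pow_const _)
  exact (h2.const_mul _).mul h1

lemma modeV_bdd (m R t : ℝ) (ht : 1 ≤ t) : ∃ C, 0 ≤ C ∧ ∀ s k, 1 ≤ s → s ≤ t → 0 < k → ‖modeV m R s k‖ ≤ C := by
  obtain ⟨U, U1, C, hC, hU, -, hUb, -, hs⟩ := hankel_asymp _ (modeNu_re m R)
  refine ⟨Real.exp (-(modeMu m R * Real.pi / 2)) * t ^ ((3 : ℝ) / 2) * C, by positivity, fun s k h1 h2 hk => ?_⟩
  have hs0 : 0 < s := by linarith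
  have hks : 0 < k * s := by positivity
  have hH : ‖hankel1 (modeNu m R) (k * s)‖ ≤ C := by
    rcases le_total (k * s) 1 with h | h
    · exact hs _ hks h
    · have h3 := hUb _ h
      rw [hU _ hks, norm_mul, Complex.norm_real, Real.norm_of_nonneg (Real.sqrt_nonneg _)] at h3
      have : 1 ≤ √(k * s) := Real.one_le_sqrt.mpr h
      exact le_trans (le_mul_of_one_le_left (norm_nonneg _) this) h3
  unfold modeV
  rw [norm_mul, norm_mul, Complex.norm_real, Complex.norm_real, Real.norm_of_nonneg (Real.exp_nonneg _),
    Real.norm_of_nonneg (by positivity)]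
  gcongr

lemma modeV_osc (m R t : ℝ) (ht : 1 ≤ t) : ∃ C, 0 ≤ C ∧ ∀ k, 1 ≤ k → ∃ w1 : ℝ → ℂ, ∀ s, 1 ≤ s → s ≤ t →
    HasDerivAt (fun s => modeV m R s k) (w1 s) s ∧ ‖modeV m R s k‖ ≤ C / √k ∧
    ‖w1 s - I * k * modeV m R s k‖ ≤ C / √k := by
  obtain ⟨U, U1, C, hC, hU, hUd, hUb, hU1, -⟩ := hankel_asymp _ (modeNu_re m R)
  set c0 := Real.exp (-(modeMu m R * Real.pi / 2)) with hc0
  have hc0p : 0 < c0 := Real.exp_pos _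
  refine ⟨c0 * (2 * t * C), by positivity, fun k hk => ?_⟩
  have hk0 : 0 < k := by linarith
  have hsk : 0 < √k := Real.sqrt_pos.mpr hk0
  have hskc : (√k : ℂ) ≠ 0 := by exact_mod_cast hsk.ne'
  have hform : ∀ s, 0 < s → modeV m R s k = c0 / √k * (s * U (s * k)) := by
    intro s hs
    unfold modeV
    rw [← hc0, mul_comm k s, hU _ (by positivity), Real.sqrt_mul hs.le]
    have e : s ^ ((3 : ℝ) / 2) = s * √s := by
      rw [Real.sqrt_eq_rpow, show (3 : ℝ) / 2 = 1 + 1 / 2 by norm_num, Real.rpow_add hs, Real.rpow_one]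
    rw [e]
    push_cast
    field_simp
  refine ⟨fun s => c0 / √k * (U (s * k) + s * (k * U1 (s * k))), fun s hs1 hst => ?_⟩
  have hs0 : 0 < s := by linarith
  have hx : 1 ≤ s * k := by nlinarith
  have hnc : ‖(c0 / √k : ℂ)‖ = c0 / √k := by
    rw [norm_div, Complex.norm_real, Complex.norm_real, Real.norm_of_nonneg hc0p.le, Real.norm_of_nonneg hsk.le]
  have hUx := hUb _ hx
  have hU1x := hU1 _ hx
  refine ⟨?_, ?_, ?_⟩
  · have hd : HasDerivAt (fun s : ℝ => (c0 / √k : ℂ) * (s * U (s * k))) (c0 / √k * (U (s * k) + s * (k * U1 (s * k)))) s := by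
      refine HasDerivAt.const_mul _ ?_
      have h1 : HasDerivAt (fun s : ℝ => (s : ℂ)) 1 s := (hasDerivAt_id s).ofReal_comp
      have h2 : HasDerivAt (fun s : ℝ => U (s * k)) (k * U1 (s * k)) s := by
        have := (hUd (s * k) (by positivity)).scomp s ((hasDerivAt_id s).mul_const k)
        simpa [Complex.real_smul, Function.comp_def] using this
      have h12 := h1.mul h2
      rw [one_mul] at h12
      exact h12
    refine hd.congr_of_eventuallyEq ?_
    filter_upwards [lt_mem_nhds hs0] with y hy using hform y hy
  · rw [hform s hs0, norm_mul, hnc, norm_mul, Complex.norm_real, Real.norm_of_nonneg hs0.le]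
    rw [div_mul_eq_mul_div]
    gcongr
    have : s * ‖U (s * k)‖ ≤ t * C := by gcongr
    nlinarith [mul_nonneg (by linarith : 0 ≤ t) hC]
  · rw [hform s hs0]
    have e : (c0 / √k * (U (s * k) + s * (k * U1 (s * k))) - I * k * (c0 / √k * (s * U (s * k))) : ℂ)
        = c0 / √k * (U (s * k) + (s * k : ℝ) * (U1 (s * k) - I * U (s * k))) := by push_cast; ring
    rw [e, norm_mul, hnc, div_mul_eq_mul_div]
    gcongr
    refine (norm_add_le _ _).trans ?_
    rw [norm_mul, Complex.norm_real, Real.norm_of_nonneg (by positivity)]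
    have : s * k * ‖U1 (s * k) - I * U (s * k)‖ ≤ C := by
      rw [le_div_iff₀ (by positivity)] at hU1x
      linarith
    nlinarith

lemma osc_integral (t a b A B G : ℝ) (ht : 1 ≤ t) (ha : 0 ≤ a) (hb : 0 ≤ b) (hA : 0 ≤ A) (hB : 0 ≤ B) (hG : 0 ≤ G)
    (u u1 g g1 v v1 : ℝ → ℂ)
    (hu : ∀ s, 1 ≤ s → s ≤ t → HasDerivAt u (u1 s) s ∧ ‖u s‖ ≤ A ∧ ‖u1 s - I * a * u s‖ ≤ A)
    (hv : ∀ s, 1 ≤ s → s ≤ t → HasDerivAt v (v1 s) s ∧ ‖v s‖ ≤ B ∧ ‖v1 s - I * b * v s‖ ≤ B)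
    (hg : ∀ s, 1 ≤ s → s ≤ t → HasDerivAt g (g1 s) s ∧ ‖g s‖ ≤ G ∧ ‖g1 s‖ ≤ G) :
    (a + b) * ‖∫ s in (1 : ℝ)..t, (starRingEnd ℂ) (u s) * g s * (starRingEnd ℂ) (v s)‖ ≤ (2 + 3 * (t - 1)) * (A * G * B) := by
  set F : ℝ → ℂ := fun s => (starRingEnd ℂ) (u s) * g s * (starRingEnd ℂ) (v s) with hF
  set F1 : ℝ → ℂ := fun s => ((starRingEnd ℂ) (u1 s) * g s + (starRingEnd ℂ) (u s) * g1 s) * (starRingEnd ℂ) (v s) +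
    (starRingEnd ℂ) (u s) * g s * (starRingEnd ℂ) (v1 s) with hF1
  have hFd : ∀ s ∈ Set.Icc 1 t, HasDerivAt F (F1 s) s := by
    intro s hs
    obtain ⟨h1, -⟩ := hu s hs.1 hs.2
    obtain ⟨h2, -⟩ := hv s hs.1 hs.2
    obtain ⟨h3, -⟩ := hg s hs.1 hs.2
    have h1' : HasDerivAt (fun s => (starRingEnd ℂ) (u s)) ((starRingEnd ℂ) (u1 s)) s := by
      simpa using h1.star
    have h2' : HasDerivAt (fun s => (starRingEnd ℂ) (v s)) ((starRingEnd ℂ) (v1 s)) s := by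
      simpa using h2.star
    exact (h1'.mul h3).mul h2'
  have hFc : ContinuousOn F (Set.Icc 1 t) := fun s hs => (hFd s hs).continuousAt.continuousWithinAt
  have hFb : ∀ s ∈ Set.Icc 1 t, ‖F s‖ ≤ A * G * B := by
    intro s hs
    obtain ⟨-, h1, -⟩ := hu s hs.1 hs.2
    obtain ⟨-, h2, -⟩ := hv s hs.1 hs.2
    obtain ⟨-, h3, -⟩ := hg s hs.1 hs.2
    simp only [hF]
    rw [norm_mul, norm_mul, RCLike.norm_conj, RCLike.norm_conj]
    gcongr
  have hintg : ∀ s ∈ Set.Icc 1 t, HasDerivWithinAt (fun s => ∫ r in (1 : ℝ)..s, F r) (F s) (Set.Icc 1 t) s := by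
    intro s hs
    have : Fact (s ∈ Set.Icc 1 t) := ⟨hs⟩
    exact intervalIntegral.integral_hasDerivWithinAt_right
      ((hFc.mono (Set.Icc_subset_Icc_right hs.2)).intervalIntegrable_of_Icc hs.1)
      (hFc.stronglyMeasurableAtFilter_nhdsWithin measurableSet_Icc s) (hFc s hs)
  have hH : ∀ s ∈ Set.Icc 1 t, HasDerivWithinAt (fun s => F s + I * (a + b) * ∫ r in (1 : ℝ)..s, F r)
      (F1 s + I * (a + b) * F s) (Set.Icc 1 t) s := fun s hs =>
    (hFd s hs).hasDerivWithinAt.add ((hintg s hs).const_mul _)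
  have hbd : ∀ s ∈ Set.Ico 1 t, ‖F1 s + I * (a + b) * F s‖ ≤ 3 * (A * G * B) := by
    intro s hs
    obtain ⟨-, h1, h1'⟩ := hu s hs.1 hs.2.le
    obtain ⟨-, h2, h2'⟩ := hv s hs.1 hs.2.le
    obtain ⟨-, h3, h3'⟩ := hg s hs.1 hs.2.le
    have e : F1 s + I * (a + b) * F s = (starRingEnd ℂ) (u1 s - I * a * u s) * g s * (starRingEnd ℂ) (v s)
      + (starRingEnd ℂ) (u s) * g1 s * (starRingEnd ℂ) (v s)
      + (starRingEnd ℂ) (u s) * g s * (starRingEnd ℂ) (v1 s - I * b * v s) := by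
      simp only [hF1, hF, map_sub, map_mul, Complex.conj_I, Complex.conj_ofReal]
      ring
    rw [e]
    refine norm_add₃_le.trans ?_
    simp only [norm_mul, RCLike.norm_conj]
    have e1 : ‖u1 s - I * a * u s‖ * ‖g s‖ * ‖v s‖ ≤ A * G * B := by gcongr
    have e2 : ‖u s‖ * ‖g1 s‖ * ‖v s‖ ≤ A * G * B := by gcongr
    have e3 : ‖u s‖ * ‖g s‖ * ‖v1 s - I * b * v s‖ ≤ A * G * B := by gcongr
    linarith
  have key := norm_image_sub_le_of_norm_deriv_le_segment' hH hbd t ⟨ht, le_rfl⟩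
  simp only [intervalIntegral.integral_same, mul_zero, add_zero] at key
  have n1 := hFb 1 ⟨le_rfl, ht⟩
  have n2 := hFb t ⟨ht, le_rfl⟩
  have e : ‖I * (a + b) * ∫ r in (1 : ℝ)..t, F r‖ = (a + b) * ‖∫ r in (1 : ℝ)..t, F r‖ := by
    rw [norm_mul, norm_mul, Complex.norm_I, one_mul, ← Complex.ofReal_add, Complex.norm_real, Real.norm_of_nonneg (by positivity)]
  rw [← e]
  have : I * (a + b) * (∫ r in (1 : ℝ)..t, F r) = (F t + I * (a + b) * (∫ r in (1 : ℝ)..t, F r) - F 1) - F t + F 1 := by ring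
  rw [this]
  have := norm_add_le ((F t + I * (a + b) * (∫ r in (1 : ℝ)..t, F r) - F 1) - F t) (F 1)
  have := norm_sub_le (F t + I * (a + b) * (∫ r in (1 : ℝ)..t, F r) - F 1) (F t)
  linarith

lemma kernel_arith (p q r T K : ℝ) (hp : 1 ≤ p) (hq : 1 ≤ q) (hr : 0 ≤ r) (hT : 0 ≤ T) (h : p ≤ q + r)
    (hK : (p + q) * T ≤ K / (√p * √q * (1 + r) ^ 4)) : T * ((1 + p) ^ 2 * (1 + r) ^ 2) ≤ 8 * K := by
  have hp0 : 0 < p := by linarith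
  have hq0 : 0 < q := by linarith
  have hsp : 0 < √p := Real.sqrt_pos.mpr hp0
  have hsq : 0 < √q := Real.sqrt_pos.mpr hq0
  rw [le_div_iff₀ (by positivity)] at hK
  have h1 : p ≤ √p * √q * (2 * (1 + r)) := by
    have : p ≤ 2 * q * (1 + r) := by nlinarith
    refine le_of_sq_le_sq ?_ (by positivity)
    have e : (√p * √q * (2 * (1 + r))) ^ 2 = p * q * (2 * (1 + r)) ^ 2 := by
      rw [mul_pow, mul_pow, Real.sq_sqrt hp0.le, Real.sq_sqrt hq0.le]
    rw [e]
    have : p * p ≤ p * (2 * q * (1 + r)) := by gcongr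
    have : p * q * (2 * (1 + r)) * 1 ≤ p * q * (2 * (1 + r)) * (2 * (1 + r)) := by
      gcongr; linarith
    nlinarith
  have h2 : (1 + p) ^ 2 ≤ 4 * (p * p) := by nlinarith
  calc T * ((1 + p) ^ 2 * (1 + r) ^ 2) ≤ T * (4 * ((p + q) * (√p * √q * (2 * (1 + r)))) * (1 + r) ^ 2) := by
        gcongr
        refine h2.trans ?_
        gcongr
        linarith
    _ = 8 * ((p + q) * T * (√p * √q * (1 + r) ^ 3)) := by ring
    _ ≤ 8 * ((p + q) * T * (√p * √q * (1 + r) ^ 4)) := by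
        gcongr
        · linarith
        · norm_num
    _ ≤ 8 * K := by gcongr

lemma kernel_bound (m R : ℝ) (W : ℝ × V3 → ℂ) (hW : ContDiff ℝ (⊤ : ℕ∞) W) (hWc : HasCompactSupport W)
    (t : ℝ) (ht : 1 ≤ t) : ∃ C, 0 ≤ C ∧ ∀ p q : V3, p ≠ 0 → q ≠ 0 →
      ‖∫ s in (1 : ℝ)..t, (starRingEnd ℂ) (modeV m R s ‖p‖) * ft (fun x => W (s, x)) (p + q) *
        (starRingEnd ℂ) (modeV m R s ‖q‖)‖ * ((1 + ‖p‖) ^ 2 * (1 + ‖p + q‖) ^ 2) ≤ C := by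
  obtain ⟨A, hA, hAb⟩ := modeV_bdd m R t ht
  obtain ⟨B, hB, hBb⟩ := modeV_osc m R t ht
  have hDc : HasCompactSupport fun y => fderiv ℝ W y ((1 : ℝ), (0 : V3)) := hWc.fderiv_apply (𝕜 := ℝ) _
  have hD : ContDiff ℝ (⊤ : ℕ∞) fun y => fderiv ℝ W y ((1 : ℝ), (0 : V3)) :=
    (hW.fderiv_right (m := ((⊤ : ℕ∞) : WithTop ℕ∞)) (by exact_mod_cast le_top)).clm_apply contDiff_const
  obtain ⟨G0, hG0, hG0b⟩ := ft_decay W hW hWc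
  obtain ⟨G1, hG1, hG1b⟩ := ft_decay _ hD hDc
  have ht0 : 0 ≤ t - 1 := by linarith
  refine ⟨8 * ((2 + 3 * (t - 1)) * (B * (G0 + G1) * B)) + 4 * ((t - 1) * (A * G0 * A)), by positivity, fun p q hp hq => ?_⟩
  have hp0 : 0 < ‖p‖ := norm_pos_iff.mpr hp
  have hq0 : 0 < ‖q‖ := norm_pos_iff.mpr hq
  have hr : 0 ≤ ‖p + q‖ := norm_nonneg _
  have hpq : ‖p‖ ≤ ‖q‖ + ‖p + q‖ := by
    have := norm_sub_le (p + q) q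
    rw [add_sub_cancel_right] at this
    linarith
  set T := ‖∫ s in (1 : ℝ)..t, (starRingEnd ℂ) (modeV m R s ‖p‖) * ft (fun x => W (s, x)) (p + q) *
        (starRingEnd ℂ) (modeV m R s ‖q‖)‖ with hTdef
  have hT : 0 ≤ T := norm_nonneg _
  have hr4 : 0 < (1 + ‖p + q‖) ^ 4 := by positivity
  by_cases hcase : 1 ≤ ‖p‖ ∧ 1 ≤ ‖q‖
  · obtain ⟨h1, h2⟩ := hcase
    obtain ⟨u1, hu1⟩ := hBb _ h1
    obtain ⟨v1, hv1⟩ := hBb _ h2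
    have hG : ∀ s, 1 ≤ s → s ≤ t → HasDerivAt (fun s => ft (fun x => W (s, x)) (p + q))
        (ft (fun x : V3 => fderiv ℝ W (s, x) (1, 0)) (p + q)) s ∧
        ‖ft (fun x => W (s, x)) (p + q)‖ ≤ (G0 + G1) / (1 + ‖p + q‖) ^ 4 ∧
        ‖ft (fun x : V3 => fderiv ℝ W (s, x) (1, 0)) (p + q)‖ ≤ (G0 + G1) / (1 + ‖p + q‖) ^ 4 := by
      intro s _ _
      refine ⟨ft_hasDerivAt W hW hWc _ s, ?_, ?_⟩
      · rw [le_div_iff₀ hr4]; linarith [hG0b s (p + q)]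
      · rw [le_div_iff₀ hr4]; linarith [hG1b s (p + q)]
    have key := osc_integral t ‖p‖ ‖q‖ _ _ _ ht hp0.le hq0.le (by positivity) (by positivity) (by positivity)
      _ u1 _ _ _ v1 hu1 hv1 hG
    have := kernel_arith ‖p‖ ‖q‖ ‖p + q‖ T ((2 + 3 * (t - 1)) * (B * (G0 + G1) * B)) h1 h2 hr hT hpq (by
      refine key.trans (le_of_eq ?_)
      have : √‖p‖ ≠ 0 := (Real.sqrt_pos.mpr hp0).ne'
      have : √‖q‖ ≠ 0 := (Real.sqrt_pos.mpr hq0).ne'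
      field_simp)
    have : 0 ≤ 4 * ((t - 1) * (A * G0 * A)) := by positivity
    linarith
  · have h1 : 1 + ‖p‖ ≤ 2 * (1 + ‖p + q‖) := by
      by_contra hcon
      exact hcase ⟨by linarith, by linarith⟩
    have hTb : T ≤ (A * (G0 / (1 + ‖p + q‖) ^ 4) * A) * |t - 1| := by
      refine intervalIntegral.norm_integral_le_of_norm_le_const fun s hs => ?_
      rw [Set.uIoc_of_le ht] at hs
      rw [norm_mul, norm_mul, RCLike.norm_conj, RCLike.norm_conj]
      have a1 := hAb s ‖p‖ hs.1.le hs.2 hp0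
      have a2 := hAb s ‖q‖ hs.1.le hs.2 hq0
      have a3 : ‖ft (fun x => W (s, x)) (p + q)‖ ≤ G0 / (1 + ‖p + q‖) ^ 4 := by
        rw [le_div_iff₀ hr4]; exact hG0b s (p + q)
      gcongr
    rw [abs_of_nonneg ht0] at hTb
    have : T * ((1 + ‖p‖) ^ 2 * (1 + ‖p + q‖) ^ 2) ≤ 4 * ((t - 1) * (A * G0 * A)) := by
      calc T * ((1 + ‖p‖) ^ 2 * (1 + ‖p + q‖) ^ 2)
          ≤ ((A * (G0 / (1 + ‖p + q‖) ^ 4) * A) * (t - 1)) * ((2 * (1 + ‖p + q‖)) ^ 2 * (1 + ‖p + q‖) ^ 2) := by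
            gcongr
        _ = _ := by field_simp; ring
    have : 0 ≤ 8 * ((2 + 3 * (t - 1)) * (B * (G0 + G1) * B)) := by positivity
    linarith

lemma weight_integrable : Integrable (fun pq : V3 × V3 =>
    ((1 + ‖pq.1‖) ^ 4)⁻¹ * ((1 + ‖pq.1 + pq.2‖) ^ 4)⁻¹) volume := by
  have h : Integrable (fun x : V3 => ((1 + ‖x‖) ^ 4)⁻¹) volume := by
    have := integrable_one_add_norm (E := V3) (μ := volume) (r := 4) (by simp; norm_num)
    refine this.congr (Eventually.of_forall fun x => ?_)
    have hx : 0 ≤ 1 + ‖x‖ := by positivity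
    simp only
    rw [Real.rpow_neg hx]
    norm_cast
  have h2 := h.mul_prod h
  have mp := measurePreserving_prod_add (volume : Measure V3) (volume : Measure V3)
  exact mp.integrable_comp_of_integrable h2

lemma param_measurable (t : ℝ) (ht : 1 ≤ t) (f : ℝ × ℝ → ℂ) (hf : Measurable f) (g : ℝ × V3 → ℂ)
    (hg : Measurable g) :
    Measurable fun pq : V3 × V3 => ∫ s in (1 : ℝ)..t, (starRingEnd ℂ) (f (s, ‖pq.1‖)) *
      g (s, pq.1 + pq.2) * (starRingEnd ℂ) (f (s, ‖pq.2‖)) := by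
  have hc : Measurable (starRingEnd ℂ) := Complex.continuous_conj.measurable
  have hA : Measurable fun z : (V3 × V3) × ℝ => (z.2, ‖z.1.1‖) := by fun_prop
  have hB : Measurable fun z : (V3 × V3) × ℝ => (z.2, ‖z.1.2‖) := by fun_prop
  have hD : Measurable fun z : (V3 × V3) × ℝ => (z.2, z.1.1 + z.1.2) := by fun_prop
  have h4 : Measurable fun z : (V3 × V3) × ℝ => (starRingEnd ℂ) (f (z.2, ‖z.1.1‖)) *
      g (z.2, z.1.1 + z.1.2) * (starRingEnd ℂ) (f (z.2, ‖z.1.2‖)) :=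
    ((hc.comp (hf.comp hA)).mul (hg.comp hD)).mul (hc.comp (hf.comp hB))
  have h5 := h4.stronglyMeasurable.integral_prod_right' (ν := volume.restrict (Set.Ioc (1 : ℝ) t))
  have h6 := h5.measurable
  simp only [intervalIntegral.integral_of_le ht]
  exact h6

lemma kernel_measurable (m R : ℝ) (W : ℝ × V3 → ℂ) (hW : Continuous W) (t : ℝ) (ht : 1 ≤ t) :
    Measurable fun pq : V3 × V3 => ∫ s in (1 : ℝ)..t, (starRingEnd ℂ) (modeV m R s ‖pq.1‖) *
      ft (fun x => W (s, x)) (pq.1 + pq.2) * (starRingEnd ℂ) (modeV m R s ‖pq.2‖) :=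
  param_measurable t ht (fun y => modeV m R y.1 y.2) (modeV_measurable m R)
    (fun y => ft (fun x => W (y.1, x)) y.2) (ft_measurable W hW)

lemma kernel_integrable (m R : ℝ) (W : ℝ × V3 → ℂ) (hW : ContDiff ℝ (⊤ : ℕ∞) W) (hWc : HasCompactSupport W)
    (t : ℝ) (ht : 1 ≤ t) : Integrable (fun pq : V3 × V3 =>
      ‖∫ s in (1 : ℝ)..t, (starRingEnd ℂ) (modeV m R s ‖pq.1‖) * ft (fun x => W (s, x)) (pq.1 + pq.2) *
        (starRingEnd ℂ) (modeV m R s ‖pq.2‖)‖ ^ 2) volume := by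
  obtain ⟨C, hC, hb⟩ := kernel_bound m R W hW hWc t ht
  refine (weight_integrable.const_mul (C ^ 2)).mono'
    ((kernel_measurable m R W hW.continuous t ht).norm.pow_const 2).aestronglyMeasurable ?_
  have h1 : ∀ᵐ pq : V3 × V3, pq.1 ≠ 0 :=
    (Measure.quasiMeasurePreserving_fst (μ := (volume : Measure V3)) (ν := (volume : Measure V3))).ae (Measure.ae_ne volume 0)
  have h2 : ∀ᵐ pq : V3 × V3, pq.2 ≠ 0 :=
    (Measure.quasiMeasurePreserving_snd (μ := (volume : Measure V3)) (ν := (volume : Measure V3))).ae (Measure.ae_ne volume 0)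
  filter_upwards [h1, h2] with pq hp hq
  have key := hb pq.1 pq.2 hp hq
  set T := ‖∫ s in (1 : ℝ)..t, (starRingEnd ℂ) (modeV m R s ‖pq.1‖) * ft (fun x => W (s, x)) (pq.1 + pq.2) *
        (starRingEnd ℂ) (modeV m R s ‖pq.2‖)‖
  have hT : 0 ≤ T := norm_nonneg _
  rw [Real.norm_of_nonneg (by positivity), ← mul_inv, ← div_eq_mul_inv, le_div_iff₀ (by positivity)]
  calc T ^ 2 * ((1 + ‖pq.1‖) ^ 4 * (1 + ‖pq.1 + pq.2‖) ^ 4)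
      = (T * ((1 + ‖pq.1‖) ^ 2 * (1 + ‖pq.1 + pq.2‖) ^ 2)) ^ 2 := by ring
    _ ≤ C ^ 2 := by gcongr

/-- for smooth compactly supported `V`, the first-order Dyson kernel
`τ′(p⃗,q⃗) = ∫₁^t conj(v(s,|p⃗|))·Ṽ(s,p⃗+q⃗)·conj(v(s,|q⃗|)) ds` is square-integrable on
`ℝ³ × ℝ³`. -/
theorem dyson_kernel_hilbert_schmidt (m R : ℝ) (hm : 0 < m) (hR : 0 < R)
    (hmR : 3 / 2 < m * R) (V : ℝ × V3 → ℝ) (hV : ContDiff ℝ (⊤ : ℕ∞) V)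
    (hVc : HasCompactSupport V) (t : ℝ) (ht : 1 ≤ t) :
    Integrable (fun pq : V3 × V3 =>
      ‖∫ s in (1 : ℝ)..t, (starRingEnd ℂ) (modeV m R s ‖pq.1‖) *
          ft (fun x => (V (s, x) : ℂ)) (pq.1 + pq.2) *
          (starRingEnd ℂ) (modeV m R s ‖pq.2‖)‖ ^ 2) volume := by
  have hW : ContDiff ℝ (⊤ : ℕ∞) (fun y : ℝ × V3 => (V y : ℂ)) :=
    Complex.ofRealCLM.contDiff.comp hV
  have hWc : HasCompactSupport (fun y : ℝ × V3 => (V y : ℂ)) :=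
    hVc.comp_left (g := fun x : ℝ => (x : ℂ)) Complex.ofReal_zero
  exact kernel_integrable m R (fun y : ℝ × V3 => (V y : ℂ)) hW hWc t ht
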